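/- arXiv:2502.08433 — 4 statements merged into one kernel-verified Lean document; each statement's English description precedes it below -/
import Mathlib

section
/- Let α ∈ ℂ with 0 < Re α ≤ 1/2, set λ = sin(πα)/π, and let (φ₁, φ₂) be an admissible weight pair. Then for all x, z > 0 with x ≠ z, the integral ∫₀^∞ R₂₃(y,z;α)/(x+y) dy converges and R₂₃(x,z;α) = 1/(x+z) + λ ∫₀^∞ R₂₃(y,z;α)/(x+y) dy. -/
open MeasureTheory Set Asymptotics

noncomputable section

/-- `r₁(x;α)` from Dixon's resolvent kernels. -/
def r1 (α : ℂ) (x : ℝ) : ℂ :=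
  if α = -(1/2 : ℂ) then
    -(2 / (Real.pi : ℂ)) * ((x : ℂ) ^ ((1 : ℂ)/2) * (Real.log x : ℂ)) / (1 - (x : ℂ) ^ 2)
  else
    (1 / Complex.cos ((Real.pi : ℂ) * α)) *
      (((x : ℂ) ^ (-α) - (x : ℂ) ^ (α + 1)) / (1 - (x : ℂ) ^ 2))

def r2 (α : ℂ) (x : ℝ) : ℂ := -(1 / (x : ℂ)) * r1 (-α) x

def r3 (α : ℂ) (x : ℝ) : ℂ := (x : ℂ) ^ 2 * r2 α x

def R1 (α : ℂ) (x y : ℝ) : ℂ := (1 / (y : ℂ)) * r1 α (x / y)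
def R2 (α : ℂ) (x y : ℝ) : ℂ := (1 / (y : ℂ)) * r2 α (x / y)
def R3 (α : ℂ) (x y : ℝ) : ℂ := (1 / (y : ℂ)) * r3 α (x / y)

/-- membership in `E`: integrable on `(0,∞)` with weight `1/(1+x)`. -/
def MemE (f : ℝ → ℂ) : Prop :=
  IntegrableOn (fun x : ℝ => f x / (1 + (x : ℂ))) (Ioi 0)

/-- membership in `E_k`: integrable on `(0,∞)` with weight `x^{k-1}`. -/
def MemEk (k : ℝ) (f : ℝ → ℂ) : Prop :=
  IntegrableOn (fun x : ℝ => (x ^ (k - 1) : ℝ) • f x) (Ioi 0)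

/-- membership in `B_{ε,η}`. -/
def MemB (ε η : ℝ) (f : ℝ → ℂ) : Prop :=
  ContinuousOn f (Ioi 0) ∧
  ∃ M : ℝ, (∀ x : ℝ, 1 < x → x ^ ε * ‖f x‖ ≤ M) ∧ (∀ x : ℝ, 0 < x → x < 1 → x ^ η * ‖f x‖ ≤ M)

/-- the norm of `B_{ε,η}`. -/
def Bnorm (ε η : ℝ) (f : ℝ → ℂ) : ℝ :=
  sSup ((fun x : ℝ => x ^ ε * ‖f x‖) '' Ioi 1) + sSup ((fun x : ℝ => x ^ η * ‖f x‖) '' Ioo 0 1)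

/-- admissible weight pair `(φ₁,φ₂)`. -/
def AdmissiblePair (φ₁ φ₂ : ℝ → ℝ) : Prop :=
  ContinuousOn φ₁ (Ioi 0) ∧ ContinuousOn φ₂ (Ioi 0) ∧
  (∀ y : ℝ, 0 < y → (φ₁ y ∈ Ioo (0:ℝ) 1 ∧ φ₂ y ∈ Ioo (0:ℝ) 1 ∧ φ₁ y + φ₂ y = 1)) ∧
  φ₁ =O[Filter.atTop] (fun y : ℝ => 1 / y) ∧
  (fun y : ℝ => φ₁ y - 1) =O[nhdsWithin 0 (Ioi 0)] (fun y : ℝ => y)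

/-- the combined kernel `R₂₃`. -/
def R23 (φ₁ φ₂ : ℝ → ℝ) (α : ℂ) (x y : ℝ) : ℂ :=
  (φ₁ y : ℂ) * R2 α x y + (φ₂ y : ℂ) * R3 α x y

theorem image_div_one_add_Ioi : (fun s : ℝ => s / (1 + s)) '' Ioi 0 = Ioo 0 1 := by
  ext x
  constructor
  · rintro ⟨s, hs, rfl⟩
    have hs : 0 < s := hs
    exact ⟨by positivity, (div_lt_one (by positivity)).2 (by linarith)⟩
  · rintro ⟨h0, h1⟩
    have h2 : (0 : ℝ) < 1 - x := by linarith
    refine ⟨x / (1 - x), mem_Ioi.2 (by positivity), ?_⟩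
    have : 1 + x / (1 - x) ≠ 0 := by positivity
    field_simp
    ring

theorem cpow_neg_div_one_add_eq (a : ℂ) {s : ℝ} (hs : 0 < s) :
    |1 / (1 + s) ^ 2| • (((s / (1 + s) : ℝ) : ℂ) ^ ((1 - a) - 1) *
      (1 - ((s / (1 + s) : ℝ) : ℂ)) ^ (a - 1)) = (s : ℂ) ^ (-a) / (1 + (s : ℂ)) := by
  have h1 : 0 < 1 + s := by linarith
  have h2 : (1 : ℂ) - ((s / (1 + s) : ℝ) : ℂ) = (((1 + s)⁻¹ : ℝ) : ℂ) := by
    rw [← Complex.ofReal_one, ← Complex.ofReal_sub]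
    congr 1
    field_simp
    ring
  have h3 : ((1 + s : ℝ) : ℂ) ≠ 0 := Complex.ofReal_ne_zero.2 h1.ne'
  have h4 : (1 : ℂ) + s = ((1 + s : ℝ) : ℂ) := by push_cast; rfl
  have h5 : ((1 + s : ℝ) : ℂ) = Complex.exp (Real.log (1 + s) : ℂ) := by
    rw [← Complex.ofReal_exp, Real.exp_log h1]
  rw [h2, abs_of_pos (by positivity), Complex.real_smul,
    Complex.cpow_def_of_ne_zero (Complex.ofReal_ne_zero.2 (by positivity)),
    Complex.cpow_def_of_ne_zero (Complex.ofReal_ne_zero.2 (by positivity)),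
    Complex.cpow_def_of_ne_zero (Complex.ofReal_ne_zero.2 hs.ne'),
    ← Complex.ofReal_log (by positivity), ← Complex.ofReal_log (by positivity),
    ← Complex.ofReal_log hs.le, Real.log_div hs.ne' h1.ne', Real.log_inv, h4, h5]
  have h6 : ((1 / (1 + s) ^ 2 : ℝ) : ℂ) = Complex.exp (-2 * (Real.log (1 + s) : ℂ)) := by
    rw [show (-2 * (Real.log (1 + s) : ℂ)) = ((-2 * Real.log (1 + s) : ℝ) : ℂ) by push_cast; ring,
      ← Complex.ofReal_exp, show -2 * Real.log (1 + s) = -(Real.log (1 + s) + Real.log (1 + s)) by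
      ring, Real.exp_neg, Real.exp_add, Real.exp_log h1, one_div, sq]
  rw [h6, ← Complex.exp_add, ← Complex.exp_add, ← Complex.exp_sub]
  congr 1
  push_cast
  ring

theorem hasDerivWithinAt_div_one_add :
    ∀ s ∈ Ioi (0 : ℝ), HasDerivWithinAt (fun s : ℝ => s / (1 + s)) (1 / (1 + s) ^ 2) (Ioi 0) s := by
  intro s hs
  have hs : 0 < s := hs
  have := ((hasDerivAt_id s).div ((hasDerivAt_id s).const_add 1) (by simp; positivity))
  refine (this.congr_deriv ?_).hasDerivWithinAt
  simp

theorem injOn_div_one_add : InjOn (fun s : ℝ => s / (1 + s)) (Ioi 0) := by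
  intro s hs t ht h
  have hs : 0 < s := hs
  have ht : 0 < t := ht
  have h : s / (1 + s) = t / (1 + t) := h
  rw [div_eq_div_iff (by positivity) (by positivity)] at h
  linarith

theorem integrableOn_cpow_neg_div_one_add {a : ℂ} (h0 : 0 < a.re) (h1 : a.re < 1) :
    IntegrableOn (fun s : ℝ => (s : ℂ) ^ (-a) / (1 + (s : ℂ))) (Ioi 0) := by
  have hc := Complex.betaIntegral_convergent (u := 1 - a) (v := a) (by simpa using h1) h0
  rw [intervalIntegrable_iff_integrableOn_Ioo_of_le zero_le_one, ← image_div_one_add_Ioi,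
    integrableOn_image_iff_integrableOn_abs_deriv_smul measurableSet_Ioi
      hasDerivWithinAt_div_one_add injOn_div_one_add] at hc
  exact hc.congr_fun (fun s hs => cpow_neg_div_one_add_eq a hs) measurableSet_Ioi

theorem integral_cpow_neg_div_one_add {a : ℂ} (h0 : 0 < a.re) (h1 : a.re < 1) :
    ∫ s in Ioi (0 : ℝ), (s : ℂ) ^ (-a) / (1 + (s : ℂ)) =
      Real.pi / Complex.sin (Real.pi * a) := by
  have hb : Complex.betaIntegral (1 - a) a = Real.pi / Complex.sin (Real.pi * a) := by
    rw [Complex.betaIntegral_eq_Gamma_mul_div _ _ (by simpa using h1) h0, sub_add_cancel,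
      Complex.Gamma_one, div_one, mul_comm, Complex.Gamma_mul_Gamma_one_sub]
  rw [← hb, Complex.betaIntegral, intervalIntegral.integral_of_le zero_le_one,
    integral_Ioc_eq_integral_Ioo, ← image_div_one_add_Ioi,
    integral_image_eq_integral_abs_deriv_smul measurableSet_Ioi
      hasDerivWithinAt_div_one_add injOn_div_one_add]
  exact (setIntegral_congr_fun measurableSet_Ioi fun s hs => cpow_neg_div_one_add_eq a hs).symm

theorem cpow_neg_div_mul_add (a : ℂ) {u s : ℝ} (hu : 0 < u) (hs : 0 < s) :
    ((u * s : ℝ) : ℂ) ^ (-a) / ((u : ℂ) + ((u * s : ℝ) : ℂ)) =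
      ((u : ℂ) ^ (-a) / u) * ((s : ℂ) ^ (-a) / (1 + (s : ℂ))) := by
  have h1 : (u : ℂ) ≠ 0 := Complex.ofReal_ne_zero.2 hu.ne'
  rw [Complex.ofReal_mul, Complex.mul_cpow_ofReal_nonneg hu.le hs.le,
    show (u : ℂ) + u * s = u * (1 + s) by ring, mul_div_mul_comm]

theorem integrableOn_cpow_neg_div_add {a : ℂ} (h0 : 0 < a.re) (h1 : a.re < 1) {u : ℝ}
    (hu : 0 < u) : IntegrableOn (fun s : ℝ => (s : ℂ) ^ (-a) / ((u : ℂ) + (s : ℂ))) (Ioi 0) := by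
  rw [← mul_zero u, ← integrableOn_Ioi_comp_mul_left_iff _ _ hu]
  exact IntegrableOn.congr_fun
    ((integrableOn_cpow_neg_div_one_add h0 h1).const_mul ((u : ℂ) ^ (-a) / u))
    (fun s hs => (cpow_neg_div_mul_add a hu hs).symm) measurableSet_Ioi

theorem integral_cpow_neg_div_add {a : ℂ} (h0 : 0 < a.re) (h1 : a.re < 1) {u : ℝ} (hu : 0 < u) :
    ∫ s in Ioi (0 : ℝ), (s : ℂ) ^ (-a) / ((u : ℂ) + (s : ℂ)) =
      (u : ℂ) ^ (-a) * (Real.pi / Complex.sin (Real.pi * a)) := by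
  have h2 : (u : ℂ) ≠ 0 := Complex.ofReal_ne_zero.2 hu.ne'
  have h := integral_comp_mul_left_Ioi (fun s : ℝ => (s : ℂ) ^ (-a) / ((u : ℂ) + (s : ℂ))) 0 hu
  rw [mul_zero, setIntegral_congr_fun measurableSet_Ioi
    (fun s hs => cpow_neg_div_mul_add a hu hs), integral_const_mul,
    integral_cpow_neg_div_one_add h0 h1, eq_inv_smul_iff₀ hu.ne', Complex.real_smul] at h
  rw [← h]
  field_simp

theorem one_sub_ofReal_ne_zero {s : ℝ} (hs : s ≠ 1) : (1 : ℂ) - s ≠ 0 := by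
  rw [sub_ne_zero, ← Complex.ofReal_one]
  exact fun h => hs (Complex.ofReal_injective h).symm

theorem add_ofReal_ne_zero {u s : ℝ} (hu : 0 < u) (hs : 0 < s) : (u : ℂ) + s ≠ 0 := by
  rw [← Complex.ofReal_add]
  exact Complex.ofReal_ne_zero.2 (by positivity)

theorem one_add_ofReal_ne_zero {s : ℝ} (hs : 0 < s) : (1 : ℂ) + s ≠ 0 := by
  simpa using add_ofReal_ne_zero one_pos hs

theorem ae_restrict_Ioi_zero_pos_and_ne (c : ℝ) :
    ∀ᵐ s ∂volume.restrict (Ioi (0 : ℝ)), 0 < s ∧ s ≠ c := by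
  filter_upwards [ae_restrict_mem measurableSet_Ioi,
    ae_restrict_of_ae (Measure.ae_ne volume c)] with s hs hs' using ⟨hs, hs'⟩

theorem integrableOn_div_one_sub {h : ℝ → ℂ} (hc : ContinuousOn h (Ioi 0))
    (hd : DifferentiableAt ℝ h 1) (h1 : h 1 = 0)
    (hi : IntegrableOn (fun s : ℝ => h s / (1 + (s : ℂ))) (Ioi 0)) :
    IntegrableOn (fun s : ℝ => h s / (1 - (s : ℂ))) (Ioi 0) := by
  have hg : ContinuousOn (dslope h 1) (Ioi 0) :=
    (continuousOn_dslope (Ioi_mem_nhds one_pos)).2 ⟨hc, hd⟩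
  have hgs : ∀ s : ℝ, s ≠ 1 → -dslope h 1 s = h s / (1 - (s : ℂ)) := by
    intro s hs
    have h2 : (1 : ℂ) - s ≠ 0 := one_sub_ofReal_ne_zero hs
    have h3 : (s : ℂ) - 1 ≠ 0 := by rwa [← neg_ne_zero, neg_sub]
    rw [dslope_of_ne _ hs, slope_def_module, h1, sub_zero, Complex.real_smul]
    push_cast
    field_simp
    ring
  suffices IntegrableOn (fun s => -dslope h 1 s) (Ioi 0) by
    refine Integrable.congr this ?_
    filter_upwards [ae_restrict_Ioi_zero_pos_and_ne 1] with s hs using hgs s hs.2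
  have hsub : Icc (1 / 2 : ℝ) 2 ⊆ Ioi 0 := fun s hs => mem_Ioi.2 (by linarith [hs.1])
  rw [← union_sdiff_cancel hsub]
  refine IntegrableOn.union ?_ ?_
  · exact (hg.mono hsub).neg.integrableOn_compact isCompact_Icc
  · have hm : MeasurableSet (Ioi (0 : ℝ) \ Icc (1 / 2) 2) := measurableSet_Ioi.diff measurableSet_Icc
    refine Integrable.mono' ((hi.mono_set sdiff_subset).norm.const_mul 3)
      ((hg.neg.mono sdiff_subset).aestronglyMeasurable hm) ?_
    filter_upwards [ae_restrict_mem hm] with s hs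
    have hs0 : 0 < s := hs.1
    have hs' : s < 1 / 2 ∨ 2 < s := by
      by_contra! hcon
      exact hs.2 ⟨hcon.1, hcon.2⟩
    rw [hgs s (by rintro rfl; rcases hs' with h | h <;> norm_num at h), norm_div, norm_div,
      ← Complex.ofReal_one, ← Complex.ofReal_sub, ← Complex.ofReal_add, Complex.norm_real,
      Complex.norm_real, Real.norm_of_nonneg (by linarith : 0 ≤ 1 + s), Real.norm_eq_abs,
      ← mul_div_assoc, div_le_div_iff₀ (abs_pos.2 (by rcases hs' with h | h <;> linarith))
      (by linarith), mul_comm (3 : ℝ), mul_assoc]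
    gcongr
    rcases hs' with h | h
    · rw [abs_of_pos (by linarith)]; linarith
    · rw [abs_of_neg (by linarith)]; linarith

theorem image_inv_Ioo_zero_one : (fun s : ℝ => s⁻¹) '' Ioo 0 1 = Ioi 1 := by
  ext x
  constructor
  · rintro ⟨s, hs, rfl⟩
    exact (one_lt_inv₀ hs.1).2 hs.2
  · intro hx
    have hx : 1 < x := hx
    exact ⟨x⁻¹, ⟨by positivity, inv_lt_one_of_one_lt₀ hx⟩, inv_inv x⟩

theorem integral_div_one_sub_eq_two_mul {h : ℝ → ℂ} (hsymm : ∀ s : ℝ, 0 < s → h s⁻¹ = -s * h s)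
    (hi : IntegrableOn (fun s : ℝ => h s / (1 - (s : ℂ))) (Ioi 0)) :
    ∫ s in Ioi (0 : ℝ), h s / (1 - (s : ℂ)) = 2 * ∫ s in Ioo (0 : ℝ) 1, h s / (1 - (s : ℂ)) := by
  have hfold : ∫ s in Ioi (1 : ℝ), h s / (1 - (s : ℂ)) =
      ∫ s in Ioo (0 : ℝ) 1, h s / (1 - (s : ℂ)) := by
    rw [← image_inv_Ioo_zero_one, integral_image_eq_integral_abs_deriv_smul measurableSet_Ioo
      (fun s hs => (hasDerivAt_inv hs.1.ne').hasDerivWithinAt) inv_injective.injOn]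
    refine setIntegral_congr_fun measurableSet_Ioo fun s hs => ?_
    have h0 : (s : ℂ) ≠ 0 := Complex.ofReal_ne_zero.2 hs.1.ne'
    have h1 : (1 : ℂ) - s ≠ 0 := one_sub_ofReal_ne_zero hs.2.ne
    have h2 : (s : ℂ) - 1 ≠ 0 := by rwa [← neg_ne_zero, neg_sub]
    have h3 : (0 : ℝ) < (s ^ 2)⁻¹ := inv_pos.2 (pow_pos hs.1 2)
    simp only [abs_neg, abs_of_pos h3, hsymm s hs.1, Complex.real_smul]
    push_cast
    have h4 : (1 : ℂ) - (s : ℂ)⁻¹ ≠ 0 := by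
      rw [show (1 : ℂ) - (s : ℂ)⁻¹ = (s - 1) / s by field_simp]
      exact div_ne_zero h2 h0
    field_simp
    ring
  rw [← Ioc_union_Ioi_eq_Ioi zero_le_one] at hi ⊢
  rw [setIntegral_union Ioc_disjoint_Ioi_same measurableSet_Ioi
    (hi.mono_set subset_union_left) (hi.mono_set subset_union_right), hfold,
    integral_Ioc_eq_integral_Ioo, two_mul]

theorem integral_div_one_add_eq_zero {h : ℝ → ℂ} (hsymm : ∀ s : ℝ, 0 < s → h s⁻¹ = -s * h s) :
    ∫ s in Ioi (0 : ℝ), h s / (1 + (s : ℂ)) = 0 := by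
  have hinv := integral_comp_rpow_Ioi (fun s : ℝ => h s / (1 + (s : ℂ))) (p := -1) (by norm_num)
  rw [setIntegral_congr_fun (g := fun s : ℝ => -(h s / (1 + (s : ℂ)))) measurableSet_Ioi,
    integral_neg] at hinv
  · linear_combination (-1 / 2 : ℂ) * hinv
  · intro s hs
    have hs : 0 < s := hs
    have h0 : (s : ℂ) ≠ 0 := Complex.ofReal_ne_zero.2 hs.ne'
    have h1 := one_add_ofReal_ne_zero hs
    have h5 : (s : ℂ) + 1 ≠ 0 := by rwa [add_comm]
    have h2 : s ^ (-1 - 1 : ℝ) = (s ^ 2)⁻¹ := by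
      rw [show (-1 - 1 : ℝ) = -((2 : ℕ) : ℝ) by norm_num, Real.rpow_neg hs.le, Real.rpow_natCast]
    have h4 : (1 : ℂ) + (s : ℂ)⁻¹ ≠ 0 := by
      rw [show (1 : ℂ) + (s : ℂ)⁻¹ = (1 + s) / s by field_simp; ring]
      exact div_ne_zero h1 h0
    simp only [abs_neg, abs_one, one_mul, h2, Real.rpow_neg_one, hsymm s hs, Complex.real_smul]
    push_cast
    field_simp
    ring

theorem integrableOn_mul_pow {h : ℝ → ℂ} (hc : ContinuousOn h (Ioi 0))
    (hi : IntegrableOn (fun s : ℝ => h s / (1 - (s : ℂ))) (Ioo 0 1)) (n : ℕ) :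
    IntegrableOn (fun s : ℝ => h s * (s : ℂ) ^ n) (Ioo 0 1) := by
  refine Integrable.mono' hi.norm
    (((hc.mono Ioo_subset_Ioi_self).mul (by fun_prop)).aestronglyMeasurable measurableSet_Ioo) ?_
  filter_upwards [ae_restrict_mem measurableSet_Ioo] with s hs
  have h1 : 0 < 1 - s := by linarith [hs.2]
  rw [norm_mul, norm_pow, norm_div, ← Complex.ofReal_one, ← Complex.ofReal_sub,
    Complex.norm_real, Complex.norm_real, Real.norm_of_nonneg hs.1.le, Real.norm_of_nonneg h1.le,
    div_eq_mul_inv]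
  gcongr
  exact (pow_le_one₀ hs.1.le hs.2.le).trans ((one_le_inv₀ h1).2 (by linarith [hs.1]))

theorem tendsto_sum_integral_mul_pow {h : ℝ → ℂ} (hc : ContinuousOn h (Ioi 0))
    (hi : IntegrableOn (fun s : ℝ => h s / (1 - (s : ℂ))) (Ioo 0 1)) :
    Filter.Tendsto (fun N => ∑ n ∈ Finset.range N, ∫ s in Ioo (0 : ℝ) 1, h s * (s : ℂ) ^ n)
      Filter.atTop (nhds (∫ s in Ioo (0 : ℝ) 1, h s / (1 - (s : ℂ)))) := by
  have hmem : ∀ᵐ s ∂volume.restrict (Ioo (0 : ℝ) 1), s ∈ Ioo (0 : ℝ) 1 :=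
    ae_restrict_mem measurableSet_Ioo
  have hm : ∀ n : ℕ, AEStronglyMeasurable (fun s : ℝ => h s * (s : ℂ) ^ n)
      (volume.restrict (Ioo 0 1)) := fun n =>
    ((hc.mono Ioo_subset_Ioi_self).mul (by fun_prop)).aestronglyMeasurable measurableSet_Ioo
  have hin := integrableOn_mul_pow hc hi
  have hsum : ∀ N : ℕ, ∀ s ∈ Ioo (0 : ℝ) 1, ∑ n ∈ Finset.range N, h s * (s : ℂ) ^ n =
      h s / (1 - (s : ℂ)) * (1 - (s : ℂ) ^ N) := by
    intro N s hs
    have h1 := one_sub_ofReal_ne_zero hs.2.ne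
    rw [← Finset.mul_sum, ← mul_neg_geom_sum]
    field_simp
  simp_rw [← integral_finsetSum _ fun n _ => hin n]
  refine tendsto_integral_of_dominated_convergence (fun s => ‖h s / (1 - (s : ℂ))‖)
    (fun N => Finset.aestronglyMeasurable_fun_sum _ fun n _ => hm n) hi.norm ?_ ?_
  · intro N
    filter_upwards [hmem] with s hs
    rw [hsum N s hs, norm_mul]
    refine mul_le_of_le_one_right (norm_nonneg _) ?_
    have h1 : s ^ N ≤ 1 := pow_le_one₀ hs.1.le hs.2.le
    have h2 : 0 ≤ s ^ N := pow_nonneg hs.1.le N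
    rw [← Complex.ofReal_one, ← Complex.ofReal_pow, ← Complex.ofReal_sub, Complex.norm_real,
      Real.norm_of_nonneg (by linarith)]
    linarith
  · filter_upwards [hmem] with s hs
    simp_rw [hsum _ s hs]
    have h1 : Filter.Tendsto (fun N : ℕ => (s : ℂ) ^ N) Filter.atTop (nhds 0) :=
      tendsto_pow_atTop_nhds_zero_of_norm_lt_one (by
        rw [Complex.norm_real, Real.norm_of_nonneg hs.1.le]; exact hs.2)
    simpa using (h1.const_sub 1).const_mul (h s / (1 - (s : ℂ)))

theorem weighted_kernel_equation {h : ℝ → ℂ} {k lam : ℂ} (h1 : h 1 = 0)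
    (hint : ∀ u : ℝ, 0 < u → IntegrableOn (fun s : ℝ => h s / ((u : ℂ) + s)) (Ioi 0))
    (hval : ∀ u : ℝ, 0 < u → lam * ∫ s in Ioi (0 : ℝ), h s / ((u : ℂ) + s) = h u)
    (hi : IntegrableOn (fun s : ℝ => h s / (1 - (s : ℂ))) (Ioi 0))
    (hL : lam * (k * ∫ s in Ioi (0 : ℝ), h s / (1 - (s : ℂ))) = -2) (q : ℂ)
    {u : ℝ} (hu : 0 < u) (hu1 : u ≠ 1) :
    IntegrableOn (fun s : ℝ => (k * h s / (1 - (s : ℂ) ^ 2) - q * (k * h s)) / ((u : ℂ) + s))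
      (Ioi 0) ∧
    k * h u / (1 - (u : ℂ) ^ 2) - q * (k * h u) = 1 / (1 + (u : ℂ)) + lam *
      ∫ s in Ioi (0 : ℝ), (k * h s / (1 - (s : ℂ) ^ 2) - q * (k * h s)) / ((u : ℂ) + s) := by
  have hu2 := one_add_ofReal_ne_zero hu
  have hu3 := one_sub_ofReal_ne_zero hu1
  have hdecomp : (fun s : ℝ => k / (2 * (1 + u)) * (h s / (1 - (s : ℂ))) +
      -k / (2 * (1 - u)) * (h s / ((1 : ℝ) + s)) +
      (k / ((1 - u) * (1 + u)) - q * k) * (h s / ((u : ℂ) + s)))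
      =ᵐ[volume.restrict (Ioi 0)]
      fun s : ℝ => (k * h s / (1 - (s : ℂ) ^ 2) - q * (k * h s)) / ((u : ℂ) + s) := by
    filter_upwards [ae_restrict_Ioi_zero_pos_and_ne 1] with s hs
    have hs1 := one_add_ofReal_ne_zero hs.1
    have hs2 := one_sub_ofReal_ne_zero hs.2
    have hs3 := add_ofReal_ne_zero hu hs.1
    rw [show (1 : ℂ) - (s : ℂ) ^ 2 = (1 - s) * (1 + s) by ring, Complex.ofReal_one]
    field_simp
    ring
  have i1 := hi.const_mul (k / (2 * (1 + u)))
  have i2 := (hint 1 one_pos).const_mul (-k / (2 * (1 - u)))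
  have i3 := (hint u hu).const_mul (k / ((1 - u) * (1 + u)) - q * k)
  have i12 : Integrable (fun s : ℝ => k / (2 * (1 + u)) * (h s / (1 - (s : ℂ))) +
      -k / (2 * (1 - u)) * (h s / ((1 : ℝ) + s))) (volume.restrict (Ioi 0)) := i1.add i2
  refine ⟨(i12.add i3).congr hdecomp, ?_⟩
  rw [← integral_congr_ae hdecomp, integral_add i12 i3, integral_add i1 i2,
    integral_const_mul, integral_const_mul, integral_const_mul, mul_add, mul_add,
    mul_left_comm lam (-k / (2 * (1 - u))), hval 1 one_pos, h1,
    mul_left_comm lam (k / ((1 - u) * (1 + u)) - q * k), hval u hu,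
    show (1 : ℂ) - (u : ℂ) ^ 2 = (1 - u) * (1 + u) by ring]
  have hL' : lam * (k / (2 * (1 + u)) * ∫ s in Ioi (0 : ℝ), h s / (1 - (s : ℂ))) =
      -1 / (1 + u) := by
    rw [show lam * (k / (2 * (1 + u)) * ∫ s in Ioi (0 : ℝ), h s / (1 - (s : ℂ))) =
      lam * (k * ∫ s in Ioi (0 : ℝ), h s / (1 - (s : ℂ))) / (2 * (1 + u)) by ring, hL]
    field_simp
  rw [hL']
  field_simp
  ring

theorem R23_equation_of_r2_eq {α k lam : ℂ} {h : ℝ → ℂ} {L : ℂ}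
    (hr2 : ∀ t : ℝ, 0 < t → r2 α t = k * h t / (1 - (t : ℂ) ^ 2))
    (hc : ContinuousOn h (Ioi 0)) (hd : DifferentiableAt ℝ h 1)
    (hsymm : ∀ s : ℝ, 0 < s → h s⁻¹ = -s * h s)
    (hint : ∀ u : ℝ, 0 < u → IntegrableOn (fun s : ℝ => h s / ((u : ℂ) + s)) (Ioi 0))
    (hval : ∀ u : ℝ, 0 < u → lam * ∫ s in Ioi (0 : ℝ), h s / ((u : ℂ) + s) = h u)
    (hsum : Filter.Tendsto
      (fun N => ∑ n ∈ Finset.range N, ∫ s in Ioo (0 : ℝ) 1, h s * (s : ℂ) ^ n)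
      Filter.atTop (nhds L))
    (hL : lam * k * L = -1) {φ₁ φ₂ : ℝ → ℝ} {x z : ℝ} (hφ : φ₁ z + φ₂ z = 1)
    (hx : 0 < x) (hz : 0 < z) (hxz : x ≠ z) :
    IntegrableOn (fun y : ℝ => R23 φ₁ φ₂ α y z / ((x : ℂ) + (y : ℂ))) (Ioi 0) ∧
      R23 φ₁ φ₂ α x z = 1 / ((x : ℂ) + (z : ℂ)) +
        lam * ∫ y in Ioi (0 : ℝ), R23 φ₁ φ₂ α y z / ((x : ℂ) + (y : ℂ)) := by
  have h1 : h 1 = 0 := by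
    have := hsymm 1 one_pos
    rw [inv_one, Complex.ofReal_one] at this
    linear_combination this / 2
  have hi : IntegrableOn (fun s : ℝ => h s / (1 - (s : ℂ))) (Ioi 0) :=
    integrableOn_div_one_sub hc hd h1 (by simpa using hint 1 one_pos)
  have hlim := tendsto_nhds_unique hsum
    (tendsto_sum_integral_mul_pow hc (hi.mono_set Ioo_subset_Ioi_self))
  have hz0 : (z : ℂ) ≠ 0 := Complex.ofReal_ne_zero.2 hz.ne'
  have hR : ∀ t : ℝ, 0 < t → t ≠ 1 → R23 φ₁ φ₂ α (z * t) z =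
      (k * h t / (1 - (t : ℂ) ^ 2) - φ₂ z * (k * h t)) / z := by
    intro t ht ht1
    have h2 := one_add_ofReal_ne_zero ht
    have h3 := one_sub_ofReal_ne_zero ht1
    have h4 : (φ₁ z : ℂ) = 1 - φ₂ z := by
      rw [eq_sub_iff_add_eq, ← Complex.ofReal_add, hφ, Complex.ofReal_one]
    rw [R23, R2, R3, r3, mul_div_cancel_left₀ _ hz.ne', hr2 t ht, h4,
      show (1 : ℂ) - (t : ℂ) ^ 2 = (1 - t) * (1 + t) by ring]
    field_simp
    ring
  have hu : 0 < x / z := by positivity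
  have hu1 : x / z ≠ 1 := fun h => hxz ((div_eq_one_iff_eq hz.ne').1 h)
  obtain ⟨hint', heq⟩ := weighted_kernel_equation (k := k) h1 hint hval hi
    (by rw [integral_div_one_sub_eq_two_mul hsymm hi, ← hlim]; linear_combination 2 * hL)
    (φ₂ z) hu hu1
  have hae : (fun s : ℝ => (1 / (z : ℂ) ^ 2) *
      ((k * h s / (1 - (s : ℂ) ^ 2) - φ₂ z * (k * h s)) / (((x / z : ℝ) : ℂ) + s)))
      =ᵐ[volume.restrict (Ioi 0)]
      fun s : ℝ => R23 φ₁ φ₂ α (z * s) z / ((x : ℂ) + ((z * s : ℝ) : ℂ)) := by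
    filter_upwards [ae_restrict_Ioi_zero_pos_and_ne 1] with s hs
    have h2 := add_ofReal_ne_zero hx (mul_pos hz hs.1)
    have h3 := add_ofReal_ne_zero hu hs.1
    have h4 : (x : ℂ) + ((z * s : ℝ) : ℂ) = z * (((x / z : ℝ) : ℂ) + s) := by
      push_cast
      field_simp
    rw [hR s hs.1 hs.2, h4, one_div_mul_eq_div, div_div, div_div]
    congr 1
    ring
  constructor
  · rw [← mul_zero z, ← integrableOn_Ioi_comp_mul_left_iff _ _ hz]
    exact (hint'.const_mul _).congr hae
  · have hscale := integral_comp_mul_left_Ioi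
      (fun y : ℝ => R23 φ₁ φ₂ α y z / ((x : ℂ) + (y : ℂ))) 0 hz
    rw [mul_zero, ← integral_congr_ae hae, integral_const_mul, eq_inv_smul_iff₀ hz.ne',
      Complex.real_smul] at hscale
    have hxR := hR (x / z) hu hu1
    rw [mul_div_cancel₀ x hz.ne', heq] at hxR
    rw [← hscale, hxR]
    have h2 := add_ofReal_ne_zero hx hz
    have h3 : (1 : ℂ) + ((x / z : ℝ) : ℂ) = (x + z) / z := by
      push_cast
      field_simp
      ring
    rw [h3]
    field_simp

theorem mem_integerComplement_of_re_mem_Ioo {a : ℂ} (h0 : 0 < a.re) (h1 : a.re < 1) :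
    a ∈ Complex.integerComplement := by
  rintro ⟨n, rfl⟩
  rw [Complex.intCast_re] at h0 h1
  have h2 : 0 < n := by exact_mod_cast h0
  have h3 : n < 1 := by exact_mod_cast h1
  omega

theorem cos_pi_mul_ne_zero {a : ℂ} (h0 : 0 < a.re) (h1 : a.re < 1) (h2 : a ≠ 1 / 2) :
    Complex.cos (Real.pi * a) ≠ 0 := by
  rw [Complex.cos_ne_zero_iff]
  intro n hn
  have hpi : (Real.pi : ℂ) ≠ 0 := Complex.ofReal_ne_zero.2 Real.pi_ne_zero
  have ha : a = (2 * n + 1) / 2 := mul_left_cancel₀ hpi (by rw [hn]; ring)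
  have hre : a.re = (2 * n + 1) / 2 := by
    rw [ha, show ((2 * n + 1) / 2 : ℂ) = (((2 * n + 1) / 2 : ℝ) : ℂ) by push_cast; rfl,
      Complex.ofReal_re]
  have h3 : (-1 : ℝ) < n := by linarith
  have h4 : (n : ℝ) < 1 := by linarith
  have h5 : -1 < n := by exact_mod_cast h3
  have h6 : n < 1 := by exact_mod_cast h4
  have h7 : n = 0 := by omega
  exact h2 (by rw [ha, h7]; simp)

theorem cpow_neg_mul_pow (a : ℂ) {s : ℝ} (hs : 0 < s) (n : ℕ) :
    (s : ℂ) ^ (-a) * (s : ℂ) ^ n = (s : ℂ) ^ (n - a) := by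
  rw [← Complex.cpow_natCast, ← Complex.cpow_add _ _ (Complex.ofReal_ne_zero.2 hs.ne')]
  ring_nf

theorem integrableOn_cpow_neg_mul_pow {a : ℂ} (h1 : a.re < 1) (n : ℕ) :
    IntegrableOn (fun s : ℝ => (s : ℂ) ^ (-a) * (s : ℂ) ^ n) (Ioo 0 1) := by
  have hre : -1 < ((n : ℂ) - a).re := by
    rw [Complex.sub_re, Complex.natCast_re]
    have : (0 : ℝ) ≤ n := n.cast_nonneg
    linarith
  have h := intervalIntegral.intervalIntegrable_cpow' (a := 0) (b := 1) hre
  rw [intervalIntegrable_iff_integrableOn_Ioo_of_le zero_le_one] at h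
  exact IntegrableOn.congr_fun h (fun s hs => (cpow_neg_mul_pow a hs.1 n).symm) measurableSet_Ioo

theorem integral_cpow_neg_mul_pow {a : ℂ} (h1 : a.re < 1) (n : ℕ) :
    ∫ s in Ioo (0 : ℝ) 1, (s : ℂ) ^ (-a) * (s : ℂ) ^ n = 1 / (n + 1 - a) := by
  have hre : -1 < ((n : ℂ) - a).re := by
    rw [Complex.sub_re, Complex.natCast_re]
    have : (0 : ℝ) ≤ n := n.cast_nonneg
    linarith
  rw [setIntegral_congr_fun measurableSet_Ioo (fun s hs => cpow_neg_mul_pow a hs.1 n),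
    ← integral_Ioc_eq_integral_Ioo, ← intervalIntegral.integral_of_le zero_le_one,
    integral_cpow (Or.inl hre), Complex.ofReal_one, Complex.one_cpow, Complex.ofReal_zero,
    Complex.zero_cpow, sub_zero]
  · ring_nf
  · intro h
    have := congrArg Complex.re h
    rw [Complex.add_re, Complex.one_re, Complex.zero_re] at this
    linarith

theorem tendsto_sum_one_div_sub_one_div {a : ℂ} (ha : a ∈ Complex.integerComplement) :
    Filter.Tendsto (fun N => ∑ n ∈ Finset.range N, (1 / ((n : ℂ) + 1 - a) - 1 / (n + a)))
      Filter.atTop (nhds (-(Real.pi * Complex.cot (Real.pi * a)))) := by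
  have hs : Filter.Tendsto (fun N => ∑ n ∈ Finset.range N, cotTerm a n) Filter.atTop
      (nhds (Real.pi * Complex.cot (Real.pi * a) - 1 / a)) := by
    rw [cot_series_rep' ha]
    exact (summable_cotTerm ha).hasSum.tendsto_sum_nat
  have hrest : Filter.Tendsto (fun N : ℕ => 1 / ((N : ℂ) + a)) Filter.atTop (nhds 0) := by
    simp only [one_div]
    exact Filter.tendsto_inv₀_cobounded.comp ((tendsto_add_const_cobounded a).comp
      tendsto_natCast_atTop_cobounded)
  have heq : ∀ N : ℕ, ∑ n ∈ Finset.range N, (1 / ((n : ℂ) + 1 - a) - 1 / (n + a)) =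
      1 / ((N : ℂ) + a) - (∑ n ∈ Finset.range N, cotTerm a n + 1 / a) := by
    intro N
    induction N with
    | zero => simp
    | succ N ih =>
      rw [Finset.sum_range_succ, Finset.sum_range_succ, ih, cotTerm,
        show a - ((N : ℂ) + 1) = -((N : ℂ) + 1 - a) by ring, one_div_neg_eq_neg_one_div]
      push_cast
      ring
  simp_rw [heq]
  convert hrest.sub (hs.add_const (1 / a)) using 2
  ring

theorem R23_equation_of_ne_half {α lam : ℂ} (hα1 : 0 < α.re) (hα2 : α.re < 1) (hα : α ≠ 1 / 2)
    (hlam : lam = Complex.sin ((Real.pi : ℂ) * α) / (Real.pi : ℂ)) {φ₁ φ₂ : ℝ → ℝ} {x z : ℝ}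
    (hφ : φ₁ z + φ₂ z = 1) (hx : 0 < x) (hz : 0 < z) (hxz : x ≠ z) :
    IntegrableOn (fun y : ℝ => R23 φ₁ φ₂ α y z / ((x : ℂ) + (y : ℂ))) (Ioi 0) ∧
      R23 φ₁ φ₂ α x z = 1 / ((x : ℂ) + (z : ℂ)) +
        lam * ∫ y in Ioi (0 : ℝ), R23 φ₁ φ₂ α y z / ((x : ℂ) + (y : ℂ)) := by
  have hpi : (Real.pi : ℂ) ≠ 0 := Complex.ofReal_ne_zero.2 Real.pi_ne_zero
  have hcomp := mem_integerComplement_of_re_mem_Ioo hα1 hα2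
  have hsin := sin_pi_mul_ne_zero hcomp
  have hcos := cos_pi_mul_ne_zero hα1 hα2 hα
  have hβ1 : 0 < (1 - α).re := by simpa using hα2
  have hβ2 : (1 - α).re < 1 := by simpa using hα1
  have hsin' : Complex.sin (Real.pi * (1 - α)) = Complex.sin (Real.pi * α) := by
    rw [mul_sub, mul_one, Complex.sin_pi_sub]
  have hdiff : ∀ s : ℝ, 0 < s →
      DifferentiableAt ℝ (fun s : ℝ => (s : ℂ) ^ (-α) - (s : ℂ) ^ (-(1 - α))) s := by
    intro s hs
    refine DifferentiableAt.sub ?_ ?_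
    · exact (hasDerivAt_ofReal_cpow_const hs.ne' (neg_ne_zero.2 fun h => by
        simp [h] at hα1)).differentiableAt
    · exact (hasDerivAt_ofReal_cpow_const hs.ne' (neg_ne_zero.2 fun h => by
        simp [h] at hβ1)).differentiableAt
  refine R23_equation_of_r2_eq (k := 1 / Complex.cos (Real.pi * α))
    (h := fun s : ℝ => (s : ℂ) ^ (-α) - (s : ℂ) ^ (-(1 - α)))
    (L := -(Real.pi * Complex.cot (Real.pi * α))) ?_
    (fun s hs => (hdiff s hs).continuousAt.continuousWithinAt) (hdiff 1 one_pos) ?_ ?_ ?_ ?_ ?_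
    hφ hx hz hxz
  · intro t ht
    have ht0 : (t : ℂ) ≠ 0 := Complex.ofReal_ne_zero.2 ht.ne'
    rw [r2, r1, if_neg (fun h => hα (neg_injective h)), mul_neg, Complex.cos_neg, neg_neg,
      show (t : ℂ) ^ (-(1 - α)) = (t : ℂ) ^ α / t by
        rw [neg_sub, Complex.cpow_sub _ _ ht0, Complex.cpow_one],
      Complex.cpow_add _ _ ht0, Complex.cpow_one]
    field_simp
    ring
  · intro s hs
    have hs0 : (s : ℂ) ≠ 0 := Complex.ofReal_ne_zero.2 hs.ne'
    have hinv : ∀ b : ℂ, ((s⁻¹ : ℝ) : ℂ) ^ (-b) = (s : ℂ) ^ b := by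
      intro b
      rw [Complex.ofReal_inv, Complex.inv_cpow _ _ (by
        rw [Complex.arg_ofReal_of_nonneg hs.le]; exact Real.pi_ne_zero.symm), Complex.cpow_neg,
        inv_inv]
    simp only [hinv]
    rw [neg_sub, Complex.cpow_sub _ _ hs0, Complex.cpow_sub _ _ hs0, Complex.cpow_neg,
      Complex.cpow_one]
    field_simp
    ring
  · intro u hu
    simp_rw [sub_div]
    exact (integrableOn_cpow_neg_div_add hα1 hα2 hu).sub (integrableOn_cpow_neg_div_add hβ1 hβ2 hu)
  · intro u hu
    simp_rw [sub_div]
    rw [integral_sub (integrableOn_cpow_neg_div_add hα1 hα2 hu)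
      (integrableOn_cpow_neg_div_add hβ1 hβ2 hu), integral_cpow_neg_div_add hα1 hα2 hu,
      integral_cpow_neg_div_add hβ1 hβ2 hu, hsin', hlam]
    field_simp
  · convert tendsto_sum_one_div_sub_one_div hcomp using 4 with N n hn
    simp_rw [sub_mul]
    rw [integral_sub (integrableOn_cpow_neg_mul_pow hα2 n) (integrableOn_cpow_neg_mul_pow hβ2 n),
      integral_cpow_neg_mul_pow hα2, integral_cpow_neg_mul_pow hβ2]
    ring_nf
  · rw [hlam, Complex.cot]
    field_simp

theorem abs_log_le_rpow {s : ℝ} (hs : 0 < s) :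
    |Real.log s| ≤ 4 * (s ^ (1 / 4 : ℝ) + s ^ (-(1 / 4) : ℝ)) := by
  have h1 := Real.log_le_rpow_div hs.le (by norm_num : (0 : ℝ) < 1 / 4)
  have h2 := Real.log_le_rpow_div (inv_pos.2 hs).le (by norm_num : (0 : ℝ) < 1 / 4)
  rw [Real.log_inv, Real.inv_rpow hs.le, ← Real.rpow_neg hs.le] at h2
  have h3 : 0 < s ^ (1 / 4 : ℝ) := Real.rpow_pos_of_pos hs _
  have h4 : 0 < s ^ (-(1 / 4) : ℝ) := Real.rpow_pos_of_pos hs _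
  rw [abs_le]
  constructor <;> linarith

/-- The function `s ↦ s^{-1/2} ln s`. -/
def logKernel (s : ℝ) : ℂ := (s : ℂ) ^ (-(1 / 2) : ℂ) * (Real.log s : ℂ)

theorem differentiableAt_logKernel {s : ℝ} (hs : 0 < s) : DifferentiableAt ℝ logKernel s := by
  refine DifferentiableAt.mul
    (hasDerivAt_ofReal_cpow_const hs.ne' (by norm_num)).differentiableAt ?_
  exact (Real.hasDerivAt_log hs.ne').ofReal_comp.differentiableAt

theorem continuousOn_logKernel : ContinuousOn logKernel (Ioi 0) :=
  fun _ hs => (differentiableAt_logKernel hs).continuousAt.continuousWithinAt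

theorem logKernel_inv {s : ℝ} (hs : 0 < s) : logKernel s⁻¹ = -s * logKernel s := by
  have hs0 : (s : ℂ) ≠ 0 := Complex.ofReal_ne_zero.2 hs.ne'
  have h1 : (s : ℂ) ^ (1 / 2 : ℂ) = s * (s : ℂ) ^ (-(1 / 2) : ℂ) := by
    rw [show (1 / 2 : ℂ) = 1 + -(1 / 2) by norm_num, Complex.cpow_add _ _ hs0, Complex.cpow_one]
    norm_num
  have h2 : ((s : ℂ) ^ (-(1 / 2) : ℂ))⁻¹ = (s : ℂ) ^ (1 / 2 : ℂ) := by
    rw [Complex.cpow_neg, inv_inv]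
  rw [logKernel, logKernel, Complex.ofReal_inv, Complex.inv_cpow _ _ (by
    rw [Complex.arg_ofReal_of_nonneg hs.le]; exact Real.pi_ne_zero.symm), h2, h1, Real.log_inv]
  push_cast
  ring

theorem integrableOn_logKernel_div_one_add :
    IntegrableOn (fun s : ℝ => logKernel s / (1 + (s : ℂ))) (Ioi 0) := by
  have i1 := integrableOn_cpow_neg_div_one_add (a := ((1 / 4 : ℝ) : ℂ))
    (by rw [Complex.ofReal_re]; norm_num) (by rw [Complex.ofReal_re]; norm_num)
  have i2 := integrableOn_cpow_neg_div_one_add (a := ((3 / 4 : ℝ) : ℂ))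
    (by rw [Complex.ofReal_re]; norm_num) (by rw [Complex.ofReal_re]; norm_num)
  refine Integrable.mono' ((i1.norm.add i2.norm).const_mul 4) ?_ ?_
  · refine ContinuousOn.aestronglyMeasurable ?_ measurableSet_Ioi
    exact continuousOn_logKernel.div (by fun_prop) fun s hs => one_add_ofReal_ne_zero hs
  · filter_upwards [ae_restrict_mem measurableSet_Ioi] with s hs
    have hs : 0 < s := hs
    simp only [Pi.add_apply, logKernel]
    rw [norm_div, norm_div, norm_div, norm_mul, Complex.norm_real, Real.norm_eq_abs,
      Complex.norm_cpow_eq_rpow_re_of_pos hs, Complex.norm_cpow_eq_rpow_re_of_pos hs,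
      Complex.norm_cpow_eq_rpow_re_of_pos hs, ← add_div, ← mul_div_assoc]
    refine div_le_div_of_nonneg_right ?_ (norm_nonneg _)
    rw [show (-(1 / 2) : ℂ) = ((-(1 / 2) : ℝ) : ℂ) by push_cast; rfl, ← Complex.ofReal_neg,
      ← Complex.ofReal_neg, Complex.ofReal_re, Complex.ofReal_re, Complex.ofReal_re]
    refine (mul_le_mul_of_nonneg_left (abs_log_le_rpow hs) (Real.rpow_nonneg hs.le _)).trans_eq ?_
    rw [mul_left_comm, mul_add, ← Real.rpow_add hs, ← Real.rpow_add hs]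
    norm_num

theorem logKernel_div_mul_add {u s : ℝ} (hu : 0 < u) (hs : 0 < s) :
    logKernel (u * s) / ((u : ℂ) + ((u * s : ℝ) : ℂ)) =
      (u : ℂ)⁻¹ * (logKernel u * ((s : ℂ) ^ (-(1 / 2) : ℂ) / (1 + (s : ℂ))) +
        (u : ℂ) ^ (-(1 / 2) : ℂ) * (logKernel s / (1 + (s : ℂ)))) := by
  have hu0 : (u : ℂ) ≠ 0 := Complex.ofReal_ne_zero.2 hu.ne'
  have hs1 := one_add_ofReal_ne_zero hs
  rw [logKernel, logKernel, logKernel, Real.log_mul hu.ne' hs.ne', Complex.ofReal_mul,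
    Complex.mul_cpow_ofReal_nonneg hu.le hs.le, show (u : ℂ) + u * s = u * (1 + s) by ring,
    Complex.ofReal_add]
  field_simp

theorem integrableOn_logKernel_div_add {u : ℝ} (hu : 0 < u) :
    IntegrableOn (fun s : ℝ => logKernel s / ((u : ℂ) + s)) (Ioi 0) := by
  have i1 := integrableOn_cpow_neg_div_one_add (a := 1 / 2) (by norm_num) (by norm_num)
  rw [← mul_zero u, ← integrableOn_Ioi_comp_mul_left_iff _ _ hu]
  exact IntegrableOn.congr_fun (((i1.const_mul (logKernel u)).add
    (integrableOn_logKernel_div_one_add.const_mul _)).const_mul _)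
    (fun s hs => (logKernel_div_mul_add hu hs).symm) measurableSet_Ioi

theorem integral_logKernel_div_add {u : ℝ} (hu : 0 < u) :
    ∫ s in Ioi (0 : ℝ), logKernel s / ((u : ℂ) + s) = Real.pi * logKernel u := by
  have hu0 : (u : ℂ) ≠ 0 := Complex.ofReal_ne_zero.2 hu.ne'
  have i1 := integrableOn_cpow_neg_div_one_add (a := 1 / 2) (by norm_num) (by norm_num)
  have v1 := integral_cpow_neg_div_one_add (a := 1 / 2) (by norm_num) (by norm_num)
  have h := integral_comp_mul_left_Ioi (fun s : ℝ => logKernel s / ((u : ℂ) + (s : ℂ))) 0 hu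
  rw [mul_zero, setIntegral_congr_fun measurableSet_Ioi
    (fun s hs => logKernel_div_mul_add hu hs), integral_const_mul,
    integral_add (i1.const_mul _) (integrableOn_logKernel_div_one_add.const_mul _),
    integral_const_mul, integral_const_mul, v1,
    integral_div_one_add_eq_zero fun s hs => logKernel_inv hs, mul_one_div, Complex.sin_pi_div_two,
    eq_inv_smul_iff₀ hu.ne', Complex.real_smul, ← mul_assoc, mul_inv_cancel₀ hu0] at h
  rw [← h]
  ring

theorem integral_logKernel_mul_pow (n : ℕ) :
    ∫ s in Ioo (0 : ℝ) 1, logKernel s * (s : ℂ) ^ n =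
      ((-(1 / ((n : ℝ) + 1 / 2) ^ 2) : ℝ) : ℂ) := by
  have hc : (0 : ℝ) < n + 1 / 2 := by positivity
  have hofReal : ∀ s ∈ Ioo (0 : ℝ) 1, logKernel s * (s : ℂ) ^ n =
      ((s ^ ((n : ℝ) - 1 / 2) * Real.log s : ℝ) : ℂ) := by
    intro s hs
    rw [logKernel, mul_right_comm, cpow_neg_mul_pow _ hs.1, Complex.ofReal_mul,
      Complex.ofReal_cpow hs.1.le]
    push_cast
    rfl
  have hi : IntegrableOn (fun s : ℝ => logKernel s / (1 - (s : ℂ))) (Ioo 0 1) :=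
    (integrableOn_div_one_sub continuousOn_logKernel (differentiableAt_logKernel one_pos)
      (by simp [logKernel]) integrableOn_logKernel_div_one_add).mono_set Ioo_subset_Ioi_self
  have hint : IntegrableOn (fun s : ℝ => s ^ ((n : ℝ) - 1 / 2) * Real.log s) (Ioo 0 1) := by
    refine IntegrableOn.congr_fun (integrableOn_mul_pow continuousOn_logKernel hi n).re
      (fun s hs => ?_) measurableSet_Ioo
    rw [hofReal s hs]
    exact Complex.ofReal_re _
  have hreal : ∫ s in Ioo (0 : ℝ) 1, s ^ ((n : ℝ) - 1 / 2) * Real.log s =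
      -(1 / ((n : ℝ) + 1 / 2) ^ 2) := by
    have h0 := tendsto_log_mul_rpow_nhdsGT_zero hc
    have h1 : Filter.Tendsto (fun s : ℝ => s ^ ((n : ℝ) + 1 / 2)) (nhdsWithin 0 (Ioi 0))
        (nhds 0) := by
      have := (Real.continuousAt_rpow_const 0 ((n : ℝ) + 1 / 2) (Or.inr hc.le)).tendsto
      rw [Real.zero_rpow hc.ne'] at this
      exact this.mono_left nhdsWithin_le_nhds
    rw [← integral_Ioc_eq_integral_Ioo, ← intervalIntegral.integral_of_le zero_le_one,
      intervalIntegral.integral_eq_sub_of_hasDerivAt_of_tendsto zero_lt_one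
      (f := fun s : ℝ => Real.log s * s ^ ((n : ℝ) + 1 / 2) / (n + 1 / 2) -
        s ^ ((n : ℝ) + 1 / 2) / (n + 1 / 2) ^ 2) (fa := 0)
      (fb := -(1 / ((n : ℝ) + 1 / 2) ^ 2)) ?_ ?_ ?_ ?_, sub_zero]
    · intro s hs
      have hs0 : 0 < s := hs.1
      have d1 := Real.hasDerivAt_log hs0.ne'
      have d2 := Real.hasDerivAt_rpow_const (x := s) (p := (n : ℝ) + 1 / 2) (Or.inl hs0.ne')
      refine (((d1.mul d2).div_const _).sub (d2.div_const _)).congr_deriv ?_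
      rw [show (n : ℝ) - 1 / 2 = n + 1 / 2 - 1 by ring]
      have hs1 : s ^ ((n : ℝ) + 1 / 2) = s ^ ((n : ℝ) + 1 / 2 - 1) * s := by
        rw [← Real.rpow_add_one hs0.ne', sub_add_cancel]
      rw [hs1]
      generalize s ^ ((n : ℝ) + 1 / 2 - 1) = w
      generalize (n : ℝ) + 1 / 2 = c at hc
      field_simp
      ring
    · rwa [intervalIntegrable_iff_integrableOn_Ioo_of_le zero_le_one]
    · simpa using (h0.div_const ((n : ℝ) + 1 / 2)).sub (h1.div_const (((n : ℝ) + 1 / 2) ^ 2))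
    · have hcont : ContinuousAt (fun s : ℝ => Real.log s * s ^ ((n : ℝ) + 1 / 2) / (n + 1 / 2) -
          s ^ ((n : ℝ) + 1 / 2) / (n + 1 / 2) ^ 2) 1 := by
        have c1 := Real.continuousAt_log one_ne_zero
        have c2 := Real.continuousAt_rpow_const 1 ((n : ℝ) + 1 / 2) (Or.inl one_ne_zero)
        exact ((c1.mul c2).div_const _).sub (c2.div_const _)
      have := hcont.tendsto.mono_left (nhdsWithin_le_nhds (s := Iio 1))
      simpa using this
  rw [← hreal, ← integral_complex_ofReal]
  exact setIntegral_congr_fun measurableSet_Ioo hofReal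

theorem hasSum_one_div_nat_add_half_sq :
    HasSum (fun n : ℕ => 1 / ((n : ℝ) + 1 / 2) ^ 2) (Real.pi ^ 2 / 2) := by
  have hodd : Summable fun n : ℕ => 1 / (((2 * n + 1 : ℕ) : ℝ)) ^ 2 :=
    hasSum_zeta_two.summable.comp_injective (i := fun n : ℕ => 2 * n + 1) fun a b h => by
      simpa using h
  have heven : HasSum (fun n : ℕ => 1 / (((2 * n : ℕ) : ℝ)) ^ 2) (Real.pi ^ 2 / 6 / 4) := by
    refine (hasSum_zeta_two.div_const 4).congr_fun fun n => ?_
    push_cast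
    rw [div_div]
    ring_nf
  have hval := (HasSum.even_add_odd (f := fun n : ℕ => 1 / (n : ℝ) ^ 2) heven
    hodd.hasSum).unique hasSum_zeta_two
  rw [show Real.pi ^ 2 / 2 = 4 * ∑' n : ℕ, 1 / (((2 * n + 1 : ℕ) : ℝ)) ^ 2 by linarith]
  refine (hodd.hasSum.mul_left 4).congr_fun fun n => ?_
  push_cast
  field_simp
  ring

theorem R23_equation_half {lam : ℂ} (hlam : lam = 1 / (Real.pi : ℂ)) {φ₁ φ₂ : ℝ → ℝ} {x z : ℝ}
    (hφ : φ₁ z + φ₂ z = 1) (hx : 0 < x) (hz : 0 < z) (hxz : x ≠ z) :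
    IntegrableOn (fun y : ℝ => R23 φ₁ φ₂ (1 / 2) y z / ((x : ℂ) + (y : ℂ))) (Ioi 0) ∧
      R23 φ₁ φ₂ (1 / 2) x z = 1 / ((x : ℂ) + (z : ℂ)) +
        lam * ∫ y in Ioi (0 : ℝ), R23 φ₁ φ₂ (1 / 2) y z / ((x : ℂ) + (y : ℂ)) := by
  have hpi : (Real.pi : ℂ) ≠ 0 := Complex.ofReal_ne_zero.2 Real.pi_ne_zero
  refine R23_equation_of_r2_eq (k := 2 / Real.pi) (h := logKernel)
    (L := ((-(Real.pi ^ 2 / 2) : ℝ) : ℂ)) ?_ continuousOn_logKernel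
    (differentiableAt_logKernel one_pos) (fun s hs => logKernel_inv hs)
    (fun u hu => integrableOn_logKernel_div_add hu) ?_ ?_ ?_ hφ hx hz hxz
  · intro t ht
    have ht0 : (t : ℂ) ≠ 0 := Complex.ofReal_ne_zero.2 ht.ne'
    have h1 : (t : ℂ) ^ (1 / 2 : ℂ) = t * (t : ℂ) ^ (-(1 / 2) : ℂ) := by
      rw [show (1 / 2 : ℂ) = 1 + -(1 / 2) by norm_num, Complex.cpow_add _ _ ht0, Complex.cpow_one]
      norm_num
    rw [r2, r1, if_pos rfl, logKernel, h1]
    field_simp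
  · intro u hu
    rw [integral_logKernel_div_add hu, hlam]
    field_simp
  · simp_rw [integral_logKernel_mul_pow, ← Complex.ofReal_sum, Finset.sum_neg_distrib]
    exact (Complex.continuous_ofReal.tendsto _).comp
      hasSum_one_div_nat_add_half_sq.tendsto_sum_nat.neg
  · rw [hlam]
    push_cast
    field_simp

/-- fundamental property of the combined kernel `R₂₃`: for
`0 < Re α ≤ 1/2`, `λ = sin(πα)/π` and an admissible weight pair,
`R₂₃(x,z;α) = 1/(x+z) + λ∫₀^∞ R₂₃(y,z;α)/(x+y) dy` for all `x, z > 0`, `x ≠ z`. -/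
theorem stmt13 (α : ℂ) (hα1 : 0 < α.re) (hα2 : α.re ≤ 1/2)
    (lam : ℂ) (hlam : lam = Complex.sin ((Real.pi : ℂ) * α) / (Real.pi : ℂ))
    (φ₁ φ₂ : ℝ → ℝ) (hφ : AdmissiblePair φ₁ φ₂) :
    ∀ x z : ℝ, 0 < x → 0 < z → x ≠ z →
      IntegrableOn (fun y : ℝ => R23 φ₁ φ₂ α y z / ((x : ℂ) + (y : ℂ))) (Ioi 0) ∧
      R23 φ₁ φ₂ α x z = 1 / ((x : ℂ) + (z : ℂ)) +
        lam * ∫ y in Ioi (0 : ℝ), R23 φ₁ φ₂ α y z / ((x : ℂ) + (y : ℂ)) := by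
  intro x z hx hz hxz
  have hz1 := (hφ.2.2.1 z hz).2.2
  by_cases hα : α = 1 / 2
  · subst hα
    refine R23_equation_half ?_ hz1 hx hz hxz
    rw [hlam, mul_one_div, Complex.sin_pi_div_two]
  · exact R23_equation_of_ne_half hα1 (by linarith) hα hlam hz1 hx hz hxz

end
end

section
/- (Proposition 2) Let λ ∈ ℂ with λ ≠ 0 and Re λ = 0. Then there exists g ∈ E such that no f ∈ E satisfies the Stieltjes equation f(x) = g(x) + λ ∫₀^∞ f(y)/(x+y) dy for almost every x > 0. -/
open MeasureTheory Set Asymptotics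

noncomputable section

theorem integrableOn_cpow_mul_exp {a : ℂ} (ha : 0 < a.re) {r : ℝ} (hr : 0 < r) :
    IntegrableOn (fun x : ℝ => (x : ℂ) ^ (a - 1) * Complex.exp (-(r * x))) (Ioi 0) := by
  have h : ∫ x in Ioi (0:ℝ), (x : ℂ) ^ (a - 1) * Complex.exp (-(r * x)) ≠ 0 := by
    rw [Complex.integral_cpow_mul_exp_neg_mul_Ioi ha (by simpa using hr)]
    refine mul_ne_zero ?_ (Complex.Gamma_ne_zero_of_re_pos ha)
    rw [Ne, Complex.cpow_eq_zero_iff]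
    simp [hr.ne']
  by_contra h'
  exact h (integral_undef h')

/-- The Stieltjes transform of a power `x ^ s` in the strip of convergence. -/
theorem stieltjes_cpow {s : ℂ} (h1 : -1 < s.re) (h2 : s.re < 0) {y : ℝ} (hy : 0 < y) :
    IntegrableOn (fun x : ℝ => (x : ℂ) ^ s / ((x : ℂ) + y)) (Ioi 0) ∧
    ∫ x in Ioi (0 : ℝ), (x : ℂ) ^ s / ((x : ℂ) + y) =
      -(Real.pi / Complex.sin (Real.pi * s)) * (y : ℂ) ^ s := by
  set F : ℝ × ℝ → ℂ := fun p => (p.2 : ℂ) ^ s * Complex.exp (-((p.1 : ℂ) * p.2)) *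
    Complex.exp (-((y : ℂ) * p.1)) with hF
  have hs1 : 0 < (s + 1).re := by simp; linarith
  have hs2 : 0 < (-s).re := by simp; linarith
  have inner : ∀ t ∈ Ioi (0:ℝ), IntegrableOn (fun x : ℝ => F (t, x)) (Ioi 0) := by
    intro t ht
    have := (integrableOn_cpow_mul_exp hs1 ht).mul_const (Complex.exp (-((y : ℂ) * t)))
    simpa [hF, IntegrableOn] using this
  have inner_val : ∀ t ∈ Ioi (0:ℝ), ∫ x in Ioi (0:ℝ), F (t, x) =
      Complex.Gamma (s + 1) * ((t : ℂ) ^ (-s - 1) * Complex.exp (-((y : ℂ) * t))) := by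
    intro t ht
    have := Complex.integral_cpow_mul_exp_neg_mul_Ioi (r := t) hs1 (by simpa using ht)
    simp only [hF, integral_mul_const]
    simp only [add_sub_cancel_right] at this
    rw [this, one_div, Complex.inv_cpow _ _ (by
      rw [Complex.arg_ofReal_of_nonneg (le_of_lt ht)]; exact Real.pi_pos.ne), ← Complex.cpow_neg]
    ring_nf
  have norm_val : ∀ t ∈ Ioi (0:ℝ), ∫ x in Ioi (0:ℝ), ‖F (t, x)‖ =
      Real.Gamma (s.re + 1) * ‖(t : ℂ) ^ (-s - 1) * Complex.exp (-((y : ℂ) * t))‖ := by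
    intro t ht
    have ht' : (0:ℝ) < t := ht
    have := Real.integral_rpow_mul_exp_neg_mul_Ioi (a := s.re + 1) (by linarith) ht'
    simp only [add_sub_cancel_right] at this
    simp only [hF, norm_mul, integral_mul_const, Complex.norm_exp]
    rw [Complex.norm_cpow_eq_rpow_re_of_pos ht', setIntegral_congr_fun (g := fun x : ℝ =>
      x ^ s.re * Real.exp (-(t * x))) measurableSet_Ioi, this, one_div,
      Real.inv_rpow ht'.le, ← Real.rpow_neg ht'.le]
    · simp
      ring_nf
    · intro x hx
      simp [Complex.norm_cpow_eq_rpow_re_of_pos hx]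
  have outer := integrableOn_cpow_mul_exp hs2 hy
  have hmeas : Measurable F := by
    rw [hF]; fun_prop
  have hint : Integrable F ((volume.restrict (Ioi 0)).prod (volume.restrict (Ioi 0))) := by
    rw [integrable_prod_iff hmeas.aestronglyMeasurable]
    constructor
    · exact (ae_restrict_mem measurableSet_Ioi).mono inner
    · refine (integrable_congr ?_).mpr (outer.norm.const_mul (Real.Gamma (s.re + 1)))
      exact (ae_restrict_mem measurableSet_Ioi).mono norm_val
  have other : ∀ x ∈ Ioi (0:ℝ), ∫ t in Ioi (0:ℝ), F (t, x) = (x : ℂ) ^ s / ((x : ℂ) + y) := by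
    intro x hx
    have hx' : (0:ℝ) < x := hx
    have := integral_exp_mul_complex_Ioi (a := -((x : ℂ) + y)) (by simp; linarith) 0
    simp only [Complex.ofReal_zero, mul_zero, Complex.exp_zero] at this
    simp only [hF, mul_assoc, ← Complex.exp_add, integral_const_mul]
    rw [div_eq_mul_inv, ← one_div, ← neg_div_neg_eq, ← this]
    congr 2
    ext t
    ring_nf
  constructor
  · refine (integrable_congr ?_).mp hint.integral_prod_right
    exact (ae_restrict_mem measurableSet_Ioi).mono other
  · rw [← setIntegral_congr_fun measurableSet_Ioi other,
      ← integral_integral_swap (f := fun t x => F (t, x)) hint,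
      setIntegral_congr_fun measurableSet_Ioi inner_val, integral_const_mul,
      Complex.integral_cpow_mul_exp_neg_mul_Ioi hs2 (by simpa using hy)]
    have hr := Complex.Gamma_mul_Gamma_one_sub (-s)
    rw [one_div, Complex.inv_cpow _ _ (by
      rw [Complex.arg_ofReal_of_nonneg hy.le]; exact Real.pi_pos.ne), ← Complex.cpow_neg, neg_neg]
    rw [sub_neg_eq_add, add_comm 1 s, mul_neg, Complex.sin_neg, div_neg] at hr
    rw [← hr]
    ring

theorem norm_cpow_sub_cpow {s : ℂ} (hs : s.re = 0) (t : ℝ) {x : ℝ} (hx : 0 < x) :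
    ‖(x : ℂ) ^ (s - t) - (x : ℂ) ^ s‖ = |x ^ (-t) - 1| := by
  have hx' : (x : ℂ) ≠ 0 := by exact_mod_cast hx.ne'
  have : (x : ℂ) ^ (s - t) - (x : ℂ) ^ s = (x : ℂ) ^ s * ((x ^ (-t) - 1 : ℝ) : ℂ) := by
    rw [sub_eq_add_neg s, Complex.cpow_add _ _ hx', Complex.ofReal_sub, Complex.ofReal_cpow hx.le]
    push_cast
    ring
  rw [this, norm_mul, Complex.norm_cpow_eq_rpow_re_of_pos hx, hs, Real.rpow_zero, one_mul,
    Complex.norm_real, Real.norm_eq_abs]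

theorem norm_cpow_sub_cpow_le_of_one_le {s : ℂ} (hs : s.re = 0) {t : ℝ} (ht : 0 ≤ t) {x : ℝ}
    (hx : 1 ≤ x) : ‖(x : ℂ) ^ (s - t) - (x : ℂ) ^ s‖ ≤ 2 * t * x ^ (1 / 2 : ℝ) := by
  have hx0 : 0 < x := by linarith
  rw [norm_cpow_sub_cpow hs t hx0, abs_sub_comm, abs_of_nonneg
    (sub_nonneg.mpr (Real.rpow_le_one_of_one_le_of_nonpos hx (by linarith)))]
  have h1 := Real.add_one_le_exp (Real.log x * -t)
  rw [← Real.rpow_def_of_pos hx0] at h1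
  have h2 := Real.log_le_rpow_div hx0.le (ε := 1 / 2) (by norm_num)
  have h3 := mul_le_mul_of_nonneg_left h2 ht
  linarith

theorem norm_cpow_sub_cpow_le_of_le_one {s : ℂ} (hs : s.re = 0) {t : ℝ} (ht : 0 ≤ t)
    (ht' : t ≤ 1 / 2) {x : ℝ} (hx0 : 0 < x) (hx : x ≤ 1) :
    ‖(x : ℂ) ^ (s - t) - (x : ℂ) ^ s‖ ≤ 4 * t * x ^ (-(3 / 4) : ℝ) := by
  have h0 : 1 ≤ x ^ (-t) := Real.one_le_rpow_of_pos_of_le_one_of_nonpos hx0 hx (by linarith)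
  rw [norm_cpow_sub_cpow hs t hx0, abs_of_nonneg (sub_nonneg.mpr h0)]
  have h1 := Real.add_one_le_exp (Real.log x * t)
  rw [← Real.rpow_def_of_pos hx0] at h1
  have h2 := Real.log_le_rpow_div (inv_pos.mpr hx0).le (ε := 1 / 4) (by norm_num)
  rw [Real.log_inv, Real.inv_rpow hx0.le, ← Real.rpow_neg hx0.le] at h2
  have h3 := mul_le_mul_of_nonneg_left h2 ht
  have h4 : x ^ (-t) * x ^ t = 1 := by rw [← Real.rpow_add hx0]; simp
  have h5 : x ^ (-t) ≤ x ^ (-(1 / 2) : ℝ) :=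
    Real.rpow_le_rpow_of_exponent_ge hx0 hx (by linarith)
  have h6 : x ^ (-(3 / 4) : ℝ) = x ^ (-(1 / 2) : ℝ) * x ^ (-(1 / 4) : ℝ) := by
    rw [← Real.rpow_add hx0]; norm_num
  have h7 : 0 ≤ t * x ^ (-(1 / 4) : ℝ) := by positivity
  calc x ^ (-t) - 1 = x ^ (-t) * (1 - x ^ t) := by rw [mul_sub, h4, mul_one]
    _ ≤ x ^ (-t) * (4 * (t * x ^ (-(1 / 4) : ℝ))) := by gcongr; linarith
    _ ≤ x ^ (-(1 / 2) : ℝ) * (4 * (t * x ^ (-(1 / 4) : ℝ))) := by gcongr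
    _ = _ := by rw [h6]; ring

/-- The Stieltjes transform of `x ^ (s - 1)` restricted to `x > 1`. -/
def truncStieltjes (s : ℂ) (y : ℝ) : ℂ := ∫ x in Ioi (1 : ℝ), (x : ℂ) ^ (s - 1) / ((x : ℂ) + y)

/-- The Stieltjes transform of `x ^ s` restricted to `x ≤ 1`. -/
def truncStieltjes' (s : ℂ) (y : ℝ) : ℂ := ∫ x in Ioc (0 : ℝ) 1, (x : ℂ) ^ s / ((x : ℂ) + y)

theorem norm_ofReal_add {x y : ℝ} (hx : 0 < x) (hy : 0 < y) : ‖(x : ℂ) + y‖ = x + y := by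
  rw [← Complex.ofReal_add, Complex.norm_real, Real.norm_of_nonneg (by positivity)]

theorem integrableOn_truncStieltjes {s : ℂ} (hs : s.re ≤ 0) {y : ℝ} (hy : 0 < y) :
    IntegrableOn (fun x : ℝ => (x : ℂ) ^ (s - 1) / ((x : ℂ) + y)) (Ioi 1) := by
  refine Integrable.mono' (integrableOn_Ioi_rpow_of_lt (a := -2) (by norm_num) one_pos)
    (Measurable.aestronglyMeasurable (by fun_prop)) ?_
  filter_upwards [ae_restrict_mem measurableSet_Ioi] with x hx
  have hx1 : (1:ℝ) < x := hx
  have hx0 : 0 < x := by linarith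
  rw [norm_div, norm_ofReal_add hx0 hy, Complex.norm_cpow_eq_rpow_re_of_pos hx0]
  calc x ^ (s - 1).re / (x + y) ≤ x ^ (-1 : ℝ) / x := by
        gcongr
        · exact hx1.le
        · simpa using hs
        · linarith
    _ = x ^ (-2 : ℝ) := by
        rw [div_eq_mul_inv, ← Real.rpow_neg_one x, ← Real.rpow_add hx0]; norm_num

theorem norm_truncStieltjes_sub_le {s : ℂ} (hs : s.re = 0) {t : ℝ} (ht : 0 ≤ t) {y : ℝ}
    (hy : 0 < y) : ‖truncStieltjes (s - t) y - truncStieltjes s y‖ ≤ 4 * t := by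
  rw [truncStieltjes, truncStieltjes, ← integral_sub
    (integrableOn_truncStieltjes (by simpa [hs] using ht) hy) (integrableOn_truncStieltjes hs.le hy)]
  have hi := integrableOn_Ioi_rpow_of_lt (a := -(3 / 2)) (by norm_num) one_pos
  have hv := integral_Ioi_rpow_of_lt (a := -(3 / 2)) (by norm_num) one_pos
  refine (norm_integral_le_of_norm_le (hi.const_mul (2 * t)) ?_).trans (le_of_eq ?_)
  · filter_upwards [ae_restrict_mem measurableSet_Ioi] with x hx
    have hx1 : (1:ℝ) < x := hx
    have hx0 : 0 < x := by linarith
    have hx' : (x : ℂ) ≠ 0 := by exact_mod_cast hx0.ne'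
    rw [Complex.cpow_sub (s - t) 1 hx', Complex.cpow_sub s 1 hx', Complex.cpow_one,
      ← sub_div, ← sub_div, norm_div, norm_div, norm_ofReal_add hx0 hy, Complex.norm_real, Real.norm_of_nonneg hx0.le]
    calc _ ≤ 2 * t * x ^ (1 / 2 : ℝ) / x / x := by
          gcongr
          · exact norm_cpow_sub_cpow_le_of_one_le hs ht hx1.le
          · linarith
      _ = _ := by
          rw [div_div, ← sq, mul_div_assoc, ← Real.rpow_natCast, ← Real.rpow_sub hx0]
          norm_num
  · rw [integral_const_mul, hv]
    norm_num
    ring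

theorem integrableOn_truncStieltjes' {s : ℂ} (hs : -1 < s.re) {y : ℝ} (hy : 0 < y) :
    IntegrableOn (fun x : ℝ => (x : ℂ) ^ s / ((x : ℂ) + y)) (Ioc 0 1) := by
  have hi : IntegrableOn (fun x : ℝ => x ^ s.re) (Ioc 0 1) := by
    rw [← intervalIntegrable_iff_integrableOn_Ioc_of_le zero_le_one]
    exact intervalIntegral.intervalIntegrable_rpow' hs
  refine Integrable.mono' (hi.div_const y) (Measurable.aestronglyMeasurable (by fun_prop)) ?_
  filter_upwards [ae_restrict_mem measurableSet_Ioc] with x hx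
  have hx0 := hx.1
  rw [norm_div, norm_ofReal_add hx0 hy, Complex.norm_cpow_eq_rpow_re_of_pos hx0]
  gcongr
  linarith

theorem norm_truncStieltjes'_sub_le {s : ℂ} (hs : s.re = 0) {t : ℝ} (ht : 0 ≤ t) (ht' : t ≤ 1 / 2)
    {y : ℝ} (hy : 1 ≤ y) : ‖truncStieltjes' (s - t) y - truncStieltjes' s y‖ ≤ 16 * t := by
  have hy0 : 0 < y := by linarith
  rw [truncStieltjes', truncStieltjes', ← integral_sub
    (integrableOn_truncStieltjes' (by simp [hs]; linarith) hy0)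
    (integrableOn_truncStieltjes' (by simp [hs]) hy0)]
  have hi : IntegrableOn (fun x : ℝ => x ^ (-(3 / 4) : ℝ)) (Ioc 0 1) := by
    rw [← intervalIntegrable_iff_integrableOn_Ioc_of_le zero_le_one]
    exact intervalIntegral.intervalIntegrable_rpow' (by norm_num)
  have hv : ∫ x : ℝ in (0:ℝ)..1, x ^ (-(3 / 4) : ℝ) = 4 := by
    rw [integral_rpow (Or.inl (by norm_num))]; norm_num
  refine (norm_integral_le_of_norm_le (hi.const_mul (4 * t)) ?_).trans (le_of_eq ?_)
  · filter_upwards [ae_restrict_mem measurableSet_Ioc] with x hx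
    have hx0 := hx.1
    rw [← sub_div, norm_div, norm_ofReal_add hx0 hy0]
    exact (div_le_self (norm_nonneg _) (by linarith)).trans
      (norm_cpow_sub_cpow_le_of_le_one hs ht ht' hx0 hx.2)
  · rw [integral_const_mul, ← intervalIntegral.integral_of_le zero_le_one, hv]
    ring

theorem truncStieltjes_eq {s : ℂ} (h1 : -1 < s.re) (h2 : s.re < 0) {y : ℝ} (hy : 0 < y) :
    truncStieltjes s y = (1 / y) *
      (-(1 / s) + Real.pi / Complex.sin (Real.pi * s) * (y : ℂ) ^ s + truncStieltjes' s y) := by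
  obtain ⟨hi, hv⟩ := stieltjes_cpow h1 h2 hy
  have hy' : (y : ℂ) ≠ 0 := by exact_mod_cast hy.ne'
  have hs' : (s - 1).re < -1 := by simp; linarith
  have hpow : IntegrableOn (fun x : ℝ => (x : ℂ) ^ (s - 1)) (Ioi 1) :=
    integrableOn_Ioi_cpow_of_lt hs' one_pos
  have hpow_val : ∫ x in Ioi (1:ℝ), (x : ℂ) ^ (s - 1) = -(1 / s) := by
    rw [integral_Ioi_cpow_of_lt hs' one_pos]
    simp [neg_div]
  have hsplit : truncStieltjes' s y + ∫ x in Ioi (1:ℝ), (x : ℂ) ^ s / ((x : ℂ) + y) =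
      -(Real.pi / Complex.sin (Real.pi * s)) * (y : ℂ) ^ s := by
    rw [← hv, ← Ioc_union_Ioi_eq_Ioi (zero_le_one (α := ℝ)), setIntegral_union
      Ioc_disjoint_Ioi_same measurableSet_Ioi (integrableOn_truncStieltjes' h1 hy)
      (hi.mono_set (Ioi_subset_Ioi zero_le_one))]
    rfl
  have hpt : ∀ x ∈ Ioi (1:ℝ), (x : ℂ) ^ (s - 1) / ((x : ℂ) + y) =
      (1 / y) * ((x : ℂ) ^ (s - 1) - (x : ℂ) ^ s / ((x : ℂ) + y)) := by
    intro x hx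
    have hx0 : (0:ℝ) < x := lt_trans one_pos hx
    have hx' : (x : ℂ) ≠ 0 := by exact_mod_cast hx0.ne'
    have hxy : (x : ℂ) + y ≠ 0 := by exact_mod_cast (add_pos hx0 hy).ne'
    rw [Complex.cpow_sub _ _ hx', Complex.cpow_one]
    field_simp
    ring
  rw [truncStieltjes, setIntegral_congr_fun measurableSet_Ioi hpt, integral_const_mul,
    integral_sub hpow (hi.mono_set (Ioi_subset_Ioi zero_le_one)), hpow_val]
  congr 1
  linear_combination -hsplit

/-- The adjoint operator `1 - lam S` applied to `x ^ (s - 1)` restricted to `x > 1`. -/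
def stieltjesResidual (lam s : ℂ) (y : ℝ) : ℂ :=
  (Ioi (1 : ℝ)).indicator (fun y : ℝ => (y : ℂ) ^ (s - 1)) y - lam * truncStieltjes s y

theorem exists_sin_pi_mul_eq {lam : ℂ} (h0 : lam ≠ 0) (hre : lam.re = 0) :
    ∃ s : ℂ, s.re = 0 ∧ s ≠ 0 ∧ Complex.sin (Real.pi * s) = lam * Real.pi := by
  have hlam : lam = lam.im * Complex.I := by
    apply Complex.ext <;> simp [hre]
  have hsin : Complex.sin (Real.pi * ((Real.arsinh (lam.im * Real.pi) / Real.pi : ℝ) * Complex.I)) =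
      lam * Real.pi := by
    rw [← mul_assoc, ← Complex.ofReal_mul, mul_div_cancel₀ _ Real.pi_ne_zero, Complex.sin_mul_I,
      ← Complex.ofReal_sinh, Real.sinh_arsinh]
    rw [hlam]
    push_cast
    simp
    ring
  refine ⟨_, ?_, ?_, hsin⟩
  · simp
  · intro h
    rw [h] at hsin
    simp [h0, Real.pi_ne_zero] at hsin

theorem stieltjesResidual_sub_le {lam s : ℂ} (h0 : lam ≠ 0) (hs : s.re = 0) (hs0 : s ≠ 0)
    (hsin : Complex.sin (Real.pi * s) = lam * Real.pi) :
    ∃ δ > 0, ∃ C : ℝ, ∃ W : ℝ → ℂ, ∀ t : ℝ, 0 < t → t < δ → ∀ y : ℝ, 0 < y →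
      ‖stieltjesResidual lam (s - t) y - W y‖ ≤ C * t / (1 + y) := by
  set μ : ℝ → ℂ := fun t => lam * Real.pi / Complex.sin (Real.pi * (s - t)) with hμ
  have hμd : DifferentiableAt ℝ μ 0 := by
    have hc : DifferentiableAt ℂ (fun z : ℂ => lam * Real.pi / Complex.sin (Real.pi * (s - z)))
        ((0 : ℝ) : ℂ) := by
      refine DifferentiableAt.div (by fun_prop) (by fun_prop) ?_
      simp [hsin, h0, Real.pi_ne_zero]
    exact hc.hasDerivAt.comp_ofReal.differentiableAt
  have hμ0 : μ 0 = 1 := by simp [hμ, hsin, h0, Real.pi_ne_zero]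
  obtain ⟨C₀, hC₀⟩ := hμd.isBigO_sub.bound
  obtain ⟨δ, hδ, hball⟩ := Metric.eventually_nhds_iff.mp hC₀
  refine ⟨min δ (1 / 2), by positivity, 8 * ‖lam‖ + 2 * (|C₀| + ‖lam‖ / ‖s‖ ^ 2 + 16 * ‖lam‖),
    fun y => if 1 < y then (1 / y) * (lam / s - lam * truncStieltjes' s y)
      else -lam * truncStieltjes s y, ?_⟩
  intro t ht htδ y hy
  have hA : 0 ≤ 8 * ‖lam‖ := by positivity
  have hB : 0 ≤ 2 * (|C₀| + ‖lam‖ / ‖s‖ ^ 2 + 16 * ‖lam‖) := by positivity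
  have hle : t ≤ 1 / 2 := (htδ.trans_le (min_le_right _ _)).le
  have hy1 : 0 < 1 + y := by linarith
  rw [stieltjesResidual]
  by_cases hy' : 1 < y
  · simp only [hy', if_true, indicator_of_mem (show y ∈ Ioi (1:ℝ) from hy')]
    have hyc : (y : ℂ) ≠ 0 := by exact_mod_cast hy.ne'
    have hst : ‖s‖ ≤ ‖s - t‖ := by
      rw [← Complex.abs_im_eq_norm.mpr hs]
      simpa using Complex.abs_im_le_norm (s - t)
    have hsn : 0 < ‖s‖ := norm_pos_iff.mpr hs0
    have hst0 : s - t ≠ 0 := norm_pos_iff.mp (hsn.trans_le hst)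
    have hinv : ‖lam / (s - t) - lam / s‖ ≤ ‖lam‖ / ‖s‖ ^ 2 * t := by
      have : lam / (s - t) - lam / s = lam * t / ((s - t) * s) := by
        field_simp
        ring
      rw [this, norm_div, norm_mul, norm_mul, Complex.norm_real, Real.norm_of_nonneg ht.le,
        div_mul_eq_mul_div, sq]
      gcongr
    have hμt : ‖1 - μ t‖ ≤ |C₀| * t := by
      have := hball (y := t) (by
        rw [Real.dist_eq, sub_zero, abs_of_pos ht]; exact htδ.trans_le (min_le_left _ _))
      rw [hμ0, sub_zero, Real.norm_of_nonneg ht.le, norm_sub_rev] at this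
      exact this.trans (by gcongr; exact le_abs_self _)
    have hpow : ‖(y : ℂ) ^ (s - t)‖ ≤ 1 := by
      rw [Complex.norm_cpow_eq_rpow_re_of_pos hy]
      exact Real.rpow_le_one_of_one_le_of_nonpos hy'.le (by simpa [hs] using ht.le)
    have hρ := norm_truncStieltjes'_sub_le hs ht.le hle hy'.le
    have key : (y : ℂ) ^ (s - t - 1) - lam * truncStieltjes (s - t) y -
        (1 / y) * (lam / s - lam * truncStieltjes' s y) =
        (1 / y) * ((y : ℂ) ^ (s - t) * (1 - μ t) + (lam / (s - t) - lam / s) -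
          lam * (truncStieltjes' (s - t) y - truncStieltjes' s y)) := by
      rw [truncStieltjes_eq (by simp [hs]; linarith) (by simpa [hs] using ht) hy,
        Complex.cpow_sub _ 1 hyc, Complex.cpow_one]
      simp only [hμ]
      ring
    rw [key, norm_mul, norm_div, norm_one, Complex.norm_real, Real.norm_of_nonneg hy.le]
    have hsum : ‖(y : ℂ) ^ (s - t) * (1 - μ t) + (lam / (s - t) - lam / s) -
          lam * (truncStieltjes' (s - t) y - truncStieltjes' s y)‖ ≤
        (|C₀| + ‖lam‖ / ‖s‖ ^ 2 + 16 * ‖lam‖) * t := by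
      refine (norm_sub_le _ _).trans ?_
      refine (add_le_add_left (norm_add_le _ _) _).trans ?_
      rw [norm_mul, norm_mul]
      have e1 := mul_le_mul hpow hμt (norm_nonneg _) zero_le_one
      have e2 := mul_le_mul_of_nonneg_left hρ (norm_nonneg lam)
      linarith
    calc _ ≤ 2 / (1 + y) * ((|C₀| + ‖lam‖ / ‖s‖ ^ 2 + 16 * ‖lam‖) * t) := by
          have : 1 / y ≤ 2 / (1 + y) := by
            rw [div_le_div_iff₀ hy hy1]
            linarith
          exact mul_le_mul this hsum (norm_nonneg _) (by positivity)
      _ = (2 * (|C₀| + ‖lam‖ / ‖s‖ ^ 2 + 16 * ‖lam‖)) * t / (1 + y) := by ring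
      _ ≤ _ := by gcongr; linarith
  · simp only [hy', if_false, indicator_of_notMem (show y ∉ Ioi (1:ℝ) from hy')]
    have hK := norm_truncStieltjes_sub_le hs ht.le hy
    have : (0 : ℂ) - lam * truncStieltjes (s - t) y - -lam * truncStieltjes s y =
        -lam * (truncStieltjes (s - t) y - truncStieltjes s y) := by ring
    rw [this, norm_mul, norm_neg]
    calc _ ≤ ‖lam‖ * (4 * t) := by gcongr
      _ ≤ 8 * ‖lam‖ * t / (1 + y) := by
          rw [le_div_iff₀ hy1]
          have : 0 ≤ ‖lam‖ * t := by positivity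
          nlinarith [not_lt.mp hy']
      _ ≤ _ := by gcongr; linarith

theorem integral_mul_stieltjesResidual {lam s : ℂ} (hs : s.re < 0) {f g : ℝ → ℂ} (hf : MemE f)
    (heq : ∀ᵐ x ∂(volume.restrict (Ioi (0 : ℝ))),
      f x = g x + lam * ∫ y in Ioi (0 : ℝ), f y / ((x : ℂ) + (y : ℂ))) :
    IntegrableOn (fun y => f y * stieltjesResidual lam s y) (Ioi 0) ∧
    ∫ y in Ioi (0 : ℝ), f y * stieltjesResidual lam s y =
      ∫ x in Ioi (1 : ℝ), (x : ℂ) ^ (s - 1) * g x := by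
  have hf' : IntegrableOn (fun x : ℝ => f x / (1 + (x : ℂ))) (Ioi 0) := hf
  have hpow : IntegrableOn (fun x : ℝ => (x : ℂ) ^ (s - 1)) (Ioi 1) :=
    integrableOn_Ioi_cpow_of_lt (by rw [Complex.sub_re, Complex.one_re]; linarith) one_pos
  have hne : ∀ y : ℝ, 0 < y → (1 + (y : ℂ)) ≠ 0 := fun y hy => by
    exact_mod_cast (add_pos one_pos hy).ne'
  have hfm : IntegrableOn (fun x : ℝ => (x : ℂ) ^ (s - 1) * f x) (Ioi 1) := by
    have h1 := hf'.mono_set (Ioi_subset_Ioi zero_le_one)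
    have h2 : IntegrableOn (fun x : ℝ => ((1 + (x : ℂ)) * (x : ℂ) ^ (s - 1)) *
        (f x / (1 + (x : ℂ)))) (Ioi 1) := by
      refine Integrable.bdd_mul (c := 2) h1 (Measurable.aestronglyMeasurable (by fun_prop)) ?_
      filter_upwards [ae_restrict_mem measurableSet_Ioi] with x hx
      have hx1 : (1:ℝ) < x := hx
      have hx0 : 0 < x := by linarith
      rw [norm_mul, Complex.norm_cpow_eq_rpow_re_of_pos hx0]
      have e1 : ‖1 + (x : ℂ)‖ ≤ 2 * x := by
        refine (norm_add_le _ _).trans ?_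
        rw [norm_one, Complex.norm_real, Real.norm_of_nonneg hx0.le]
        linarith
      have e2 : x ^ (s - 1).re ≤ x ^ (-1 : ℝ) :=
        Real.rpow_le_rpow_of_exponent_le hx1.le (by simpa using hs.le)
      calc _ ≤ 2 * x * x ^ (-1 : ℝ) := by gcongr
        _ = 2 := by rw [Real.rpow_neg_one]; field_simp
    refine (integrableOn_congr_fun ?_ measurableSet_Ioi).mp h2
    intro x hx
    have := hne x (lt_trans one_pos hx)
    field_simp
  have hprod : Integrable (fun p : ℝ × ℝ => (p.1 : ℂ) ^ (s - 1) * (f p.2 / ((p.1 : ℂ) + p.2)))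
      ((volume.restrict (Ioi 1)).prod (volume.restrict (Ioi 0))) := by
    have h1 := hpow.mul_prod hf'
    have hmem : ∀ᵐ p : ℝ × ℝ ∂((volume.restrict (Ioi 1)).prod (volume.restrict (Ioi 0))),
        p ∈ Ioi (1:ℝ) ×ˢ Ioi (0:ℝ) := by
      rw [Measure.prod_restrict]
      exact ae_restrict_mem (measurableSet_Ioi.prod measurableSet_Ioi)
    have h2 := Integrable.bdd_mul (c := 1) (f := fun p : ℝ × ℝ => (1 + (p.2 : ℂ)) / (p.1 + p.2)) h1
      (Measurable.aestronglyMeasurable (by fun_prop)) ?_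
    · refine (integrable_congr ?_).mp h2
      filter_upwards [hmem] with p hp
      have := hne p.2 hp.2
      field_simp
    · filter_upwards [hmem] with p hp
      have hp1 : 1 < p.1 := hp.1
      have hp2 : 0 < p.2 := hp.2
      have e := norm_ofReal_add one_pos hp2
      rw [Complex.ofReal_one] at e
      rw [norm_div, norm_ofReal_add (by linarith) hp2, e]
      exact (div_le_one (by linarith)).mpr (by linarith)
  have hinner : ∀ y : ℝ, ∫ x in Ioi (1:ℝ), (x : ℂ) ^ (s - 1) * (f y / ((x : ℂ) + y)) =
      f y * truncStieltjes s y := by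
    intro y
    rw [truncStieltjes, ← integral_const_mul]
    congr 1
    ext x
    ring
  have hright : IntegrableOn (fun y => f y * truncStieltjes s y) (Ioi 0) := by
    simpa only [hinner, IntegrableOn] using hprod.integral_prod_right
  have hleft := hprod.integral_prod_left
  have hswap := integral_integral_swap
    (f := fun x y : ℝ => (x : ℂ) ^ (s - 1) * (f y / ((x : ℂ) + y))) hprod
  simp only [hinner] at hswap
  have hind : (fun y => f y * stieltjesResidual lam s y) = fun y =>
      (Ioi (1:ℝ)).indicator (fun x : ℝ => (x : ℂ) ^ (s - 1) * f x) y -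
        lam * (f y * truncStieltjes s y) := by
    ext y
    by_cases hy : y ∈ Ioi (1:ℝ) <;> simp only [stieltjesResidual, hy, indicator_of_mem,
      indicator_of_notMem, not_false_eq_true] <;> ring
  have hfi : IntegrableOn ((Ioi (1:ℝ)).indicator (fun x : ℝ => (x : ℂ) ^ (s - 1) * f x))
      (Ioi 0) := (hfm.integrable_indicator measurableSet_Ioi).integrableOn
  rw [hind]
  refine ⟨hfi.sub (hright.const_mul lam), ?_⟩
  rw [integral_sub hfi (hright.const_mul lam), setIntegral_indicator measurableSet_Ioi,
    inter_eq_self_of_subset_right (Ioi_subset_Ioi zero_le_one), integral_const_mul, ← hswap,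
    ← integral_const_mul, ← integral_sub hfm (hleft.const_mul lam)]
  refine integral_congr_ae ?_
  filter_upwards [ae_restrict_of_ae_restrict_of_subset (Ioi_subset_Ioi zero_le_one) heq] with x hx
  rw [integral_const_mul]
  linear_combination (x : ℂ) ^ (s - 1) * hx

theorem integrableOn_rpow_div_log_sq {t : ℝ} (ht : 0 ≤ t) :
    IntegrableOn (fun x : ℝ => x ^ (-t - 1) / Real.log x ^ 2) (Ioi (Real.exp 1)) := by
  have h := integrableOn_inv_div_log_sq_Ioi (Real.one_lt_exp_iff.mpr one_pos)
  refine Integrable.mono' h (Measurable.aestronglyMeasurable (by fun_prop)) ?_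
  filter_upwards [ae_restrict_mem measurableSet_Ioi] with x hx
  have hx1 : 1 < x := (Real.one_lt_exp_iff.mpr one_pos).trans hx
  have hx0 : 0 < x := by linarith
  rw [Real.norm_of_nonneg (by positivity), ← Real.rpow_neg_one x]
  gcongr
  · exact hx1.le
  · linarith

theorem integral_inv_mul_log {t : ℝ} (ht : 0 < t) (ht1 : t ≤ 1) :
    IntegrableOn (fun x : ℝ => x⁻¹ / Real.log x) (Ioc (Real.exp 1) (Real.exp (1 / t))) ∧
    ∫ x in Ioc (Real.exp 1) (Real.exp (1 / t)), x⁻¹ / Real.log x = -Real.log t := by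
  have hle : Real.exp 1 ≤ Real.exp (1 / t) :=
    Real.exp_le_exp.mpr ((le_div_iff₀ ht).mpr (by linarith))
  have hpos : ∀ x ∈ uIcc (Real.exp 1) (Real.exp (1 / t)), 0 < x ∧ 0 < Real.log x := by
    intro x hx
    rw [uIcc_of_le hle] at hx
    have h1 : 1 < x := (Real.one_lt_exp_iff.mpr one_pos).trans_le hx.1
    exact ⟨by linarith, Real.log_pos h1⟩
  have hi : IntervalIntegrable (fun x : ℝ => x⁻¹ / Real.log x) volume (Real.exp 1)
      (Real.exp (1 / t)) := by
    refine ContinuousOn.intervalIntegrable ?_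
    intro x hx
    have h1 := (hpos x hx).1.ne'
    have h2 := (hpos x hx).2.ne'
    exact ((continuousAt_id.inv₀ h1).div (Real.continuousAt_log h1) h2).continuousWithinAt
  refine ⟨(intervalIntegrable_iff_integrableOn_Ioc_of_le hle).mp hi, ?_⟩
  rw [← intervalIntegral.integral_of_le hle, intervalIntegral.integral_eq_sub_of_hasDerivAt
    (f := fun x => Real.log (Real.log x)) ?_ hi]
  · simp
  · intro x hx
    exact (Real.hasDerivAt_log (hpos x hx).1.ne').log (hpos x hx).2.ne'

theorem le_integral_rpow_div_log_sq_sub {t : ℝ} (ht : 0 < t) (ht1 : t ≤ 1) :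
    t / (2 * Real.exp 1) * -Real.log t ≤
      (∫ x in Ioi (Real.exp 1), x ^ (-(t / 2) - 1) / Real.log x ^ 2) -
        ∫ x in Ioi (Real.exp 1), x ^ (-t - 1) / Real.log x ^ 2 := by
  obtain ⟨hi, hv⟩ := integral_inv_mul_log ht ht1
  have hd := (integrableOn_rpow_div_log_sq (half_pos ht).le).sub (integrableOn_rpow_div_log_sq ht.le)
  rw [← hv, ← integral_const_mul, ← integral_sub (integrableOn_rpow_div_log_sq (half_pos ht).le)
    (integrableOn_rpow_div_log_sq ht.le)]
  have hstep : ∫ x in Ioc (Real.exp 1) (Real.exp (1 / t)), t / (2 * Real.exp 1) *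
      (x⁻¹ / Real.log x) ≤ ∫ x in Ioc (Real.exp 1) (Real.exp (1 / t)),
        (x ^ (-(t / 2) - 1) / Real.log x ^ 2 - x ^ (-t - 1) / Real.log x ^ 2) := by
    refine setIntegral_mono_on (hi.const_mul _) (hd.mono_set Ioc_subset_Ioi_self)
      measurableSet_Ioc ?_
    intro x hx
    have hx1 : 1 < x := (Real.one_lt_exp_iff.mpr one_pos).trans hx.1
    have hx0 : 0 < x := by linarith
    have hlog : 0 < Real.log x := Real.log_pos hx1
    have hlog' : Real.log x ≤ 1 / t := (Real.log_le_iff_le_exp hx0).mpr hx.2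
    set v := t / 2 * Real.log x with hv
    have hv0 : 0 < v := by positivity
    have hv1 : 2 * v ≤ 1 := by
      rw [le_div_iff₀ ht] at hlog'
      rw [hv]; linarith
    have e1 : x ^ (-(t / 2) - 1) = Real.exp (-v) * x⁻¹ := by
      rw [sub_eq_add_neg, Real.rpow_add hx0, Real.rpow_neg_one, Real.rpow_def_of_pos hx0, hv]
      ring_nf
    have e2 : x ^ (-t - 1) = Real.exp (-(2 * v)) * x⁻¹ := by
      rw [sub_eq_add_neg, Real.rpow_add hx0, Real.rpow_neg_one, Real.rpow_def_of_pos hx0, hv]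
      ring_nf
    have e3 : v * Real.exp (-1) ≤ Real.exp (-v) - Real.exp (-(2 * v)) := by
      have h1 := Real.add_one_le_exp v
      have h2 : Real.exp (-1) ≤ Real.exp (-(2 * v)) := Real.exp_le_exp.mpr (by linarith)
      have h3 : Real.exp (-v) = Real.exp v * Real.exp (-(2 * v)) := by
        rw [← Real.exp_add]; ring_nf
      rw [h3]
      nlinarith [Real.exp_pos (-(2 * v))]
    rw [e1, e2, ← sub_div, ← sub_mul, le_div_iff₀ (by positivity)]
    calc t / (2 * Real.exp 1) * (x⁻¹ / Real.log x) * Real.log x ^ 2 =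
          v * Real.exp (-1) * x⁻¹ := by
            rw [Real.exp_neg, hv]; field_simp
      _ ≤ _ := by gcongr
  refine hstep.trans (setIntegral_mono_set hd ?_ Ioc_subset_Ioi_self.eventuallyLE)
  filter_upwards [ae_restrict_mem measurableSet_Ioi] with x hx
  have hx1 : 1 < x := (Real.one_lt_exp_iff.mpr one_pos).trans hx
  have : x ^ (-t - 1) ≤ x ^ (-(t / 2) - 1) :=
    Real.rpow_le_rpow_of_exponent_le hx1.le (by linarith)
  simp only [Pi.zero_apply, sub_nonneg]
  gcongr

/-- A right-hand side whose truncated Mellin transform is not Lipschitz at `s`. -/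
def obstructingRhs (s : ℂ) : ℝ → ℂ :=
  (Ioi (Real.exp 1)).indicator fun x => (x : ℂ) ^ (-s) / (Real.log x : ℂ) ^ 2

theorem memE_obstructingRhs {s : ℂ} (hs : s.re = 0) : MemE (obstructingRhs s) := by
  have hmeas : Measurable (obstructingRhs s) :=
    Measurable.indicator (by fun_prop) measurableSet_Ioi
  have h : Integrable ((Ioi (Real.exp 1)).indicator fun x : ℝ => x⁻¹ / Real.log x ^ 2) :=
    (integrableOn_inv_div_log_sq_Ioi (Real.one_lt_exp_iff.mpr one_pos)).integrable_indicator
      measurableSet_Ioi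
  refine Integrable.mono' h.integrableOn (Measurable.aestronglyMeasurable (by fun_prop)) ?_
  filter_upwards [ae_restrict_mem measurableSet_Ioi] with x hx
  have hx0 : (0:ℝ) < x := hx
  by_cases hxe : x ∈ Ioi (Real.exp 1)
  · have e := norm_ofReal_add one_pos hx0
    rw [Complex.ofReal_one] at e
    simp only [obstructingRhs, indicator_of_mem hxe]
    rw [norm_div, norm_div, e, Complex.norm_cpow_eq_rpow_re_of_pos hx0, norm_pow,
      Complex.norm_real, Real.norm_eq_abs, sq_abs, Complex.neg_re, hs, neg_zero, Real.rpow_zero,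
      div_right_comm, ← one_div x]
    gcongr
    linarith
  · simp [obstructingRhs, indicator_of_notMem hxe]

theorem integral_obstructingRhs (s : ℂ) (t : ℝ) :
    ∫ x in Ioi (1 : ℝ), (x : ℂ) ^ (s - t - 1) * obstructingRhs s x =
      ((∫ x in Ioi (Real.exp 1), x ^ (-t - 1) / Real.log x ^ 2 : ℝ) : ℂ) := by
  have hind : (fun x : ℝ => (x : ℂ) ^ (s - t - 1) * obstructingRhs s x) =
      (Ioi (Real.exp 1)).indicator fun x : ℝ =>
        (x : ℂ) ^ (s - t - 1) * ((x : ℂ) ^ (-s) / (Real.log x : ℂ) ^ 2) := by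
    ext x
    by_cases hx : x ∈ Ioi (Real.exp 1) <;> simp [obstructingRhs, hx]
  rw [hind, setIntegral_indicator measurableSet_Ioi, inter_eq_self_of_subset_right
    (Ioi_subset_Ioi (Real.one_lt_exp_iff.mpr one_pos).le), ← integral_complex_ofReal]
  refine setIntegral_congr_fun measurableSet_Ioi fun x hx => ?_
  have hx0 : 0 < x := (Real.exp_pos 1).trans hx
  have hx' : (x : ℂ) ≠ 0 := by exact_mod_cast hx0.ne'
  push_cast [Complex.ofReal_cpow hx0.le]
  rw [mul_div_assoc', ← Complex.cpow_add _ _ hx']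
  ring_nf

/-- Proposition 2: for nonzero purely imaginary `λ` there exists
`g ∈ E` such that no `f ∈ E` satisfies the Stieltjes equation a.e. -/
theorem stmt14 (lam : ℂ) (h0 : lam ≠ 0) (hre : lam.re = 0) :
    ∃ g : ℝ → ℂ, MemE g ∧
      ¬ ∃ f : ℝ → ℂ, MemE f ∧
        (∀ x : ℝ, 0 < x → IntegrableOn (fun y : ℝ => f y / ((x : ℂ) + (y : ℂ))) (Ioi 0)) ∧
        (∀ᵐ x ∂(volume.restrict (Ioi (0 : ℝ))),
          f x = g x + lam * ∫ y in Ioi (0 : ℝ), f y / ((x : ℂ) + (y : ℂ))) := by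
  obtain ⟨s, hs, hs0, hsin⟩ := exists_sin_pi_mul_eq h0 hre
  refine ⟨obstructingRhs s, memE_obstructingRhs hs, ?_⟩
  rintro ⟨f, hf, -, heq⟩
  obtain ⟨δ, hδ, C, W, hW⟩ := stieltjesResidual_sub_le h0 hs hs0 hsin
  set M := ∫ y in Ioi (0 : ℝ), ‖f y / (1 + (y : ℂ))‖ with hM
  have hupper : ∀ t : ℝ, 0 < t → t < δ →
      (∫ x in Ioi (Real.exp 1), x ^ (-(t / 2) - 1) / Real.log x ^ 2) -
        (∫ x in Ioi (Real.exp 1), x ^ (-t - 1) / Real.log x ^ 2) ≤ 3 / 2 * C * t * M := by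
    intro t ht htδ
    obtain ⟨i1, v1⟩ := integral_mul_stieltjesResidual (s := s - (t / 2 : ℝ))
      (by simp [hs]; linarith) hf heq
    obtain ⟨i2, v2⟩ := integral_mul_stieltjesResidual (s := s - t)
      (by simp [hs]; linarith) hf heq
    rw [integral_obstructingRhs] at v1 v2
    refine (le_abs_self _).trans ?_
    rw [← Real.norm_eq_abs, ← Complex.norm_real, Complex.ofReal_sub, ← v1, ← v2,
      ← integral_sub i1 i2, hM, ← integral_const_mul]
    refine norm_integral_le_of_norm_le (hf.norm.const_mul _) ?_
    filter_upwards [ae_restrict_mem measurableSet_Ioi] with y hy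
    have hy0 : (0:ℝ) < y := hy
    have w1 := hW (t / 2) (half_pos ht) (by linarith) y hy
    have w2 := hW t ht htδ y hy
    have e := norm_ofReal_add one_pos hy0
    rw [Complex.ofReal_one] at e
    have w3 : ‖stieltjesResidual lam (s - (t / 2 : ℝ)) y - stieltjesResidual lam (s - t) y‖ ≤
        3 / 2 * C * t / (1 + y) := by
      refine (norm_sub_le_norm_sub_add_norm_sub _ (W y) _).trans ?_
      rw [norm_sub_rev (W y)]
      refine (add_le_add w1 w2).trans (le_of_eq ?_)
      ring
    rw [← mul_sub, norm_mul, norm_div, e]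
    calc _ ≤ ‖f y‖ * (3 / 2 * C * t / (1 + y)) := by gcongr
      _ = _ := by ring
  set B := 3 * Real.exp 1 * C * M with hB
  set t := min (min (δ / 2) 1) (Real.exp (-(B + 1))) with ht
  have ht0 : 0 < t := by positivity
  have htδ : t < δ := lt_of_le_of_lt ((min_le_left _ _).trans (min_le_left _ _)) (by linarith)
  have ht1 : t ≤ 1 := (min_le_left _ _).trans (min_le_right _ _)
  have hlog : Real.log t ≤ -(B + 1) := (Real.log_le_iff_le_exp ht0).mpr (min_le_right _ _)
  have hfin := (le_integral_rpow_div_log_sq_sub ht0 ht1).trans (hupper t ht0 htδ)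
  have : t * (-Real.log t) ≤ t * B := by
    have he := Real.exp_pos 1
    calc t * (-Real.log t) = 2 * Real.exp 1 * (t / (2 * Real.exp 1) * -Real.log t) := by
          field_simp
      _ ≤ 2 * Real.exp 1 * (3 / 2 * C * t * M) := by gcongr
      _ = t * B := by rw [hB]; ring
  have := le_of_mul_le_mul_left this ht0
  linarith

end
end

section
/- (Proposition 3) Let 0 < ε, η < 1. For every f ∈ B_{ε,η} and every x > 0 the integral ∫₀^∞ |f(y)|/(x+y) dy is finite, the function (Sf)(x) = ∫₀^∞ f(y)/(x+y) dy is continuous on (0,∞) and belongs to B_{ε,η}, and there exists a constant C = C(ε,η) > 0, independent of f, such that ‖Sf‖_{ε,η} ≤ C·‖f‖_{ε,η}. -/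
open MeasureTheory Set Asymptotics

noncomputable section

namespace Stieltjes

lemma integrableOn_rpow_neg_div_add {a x : ℝ} (ha0 : 0 < a) (ha1 : a < 1) (hx : 0 < x) :
    IntegrableOn (fun y : ℝ => y ^ (-a) / (x + y)) (Ioi 0) ∧
      ∫ y in Ioi (0 : ℝ), y ^ (-a) / (x + y) ≤ (1 / (1 - a) + 1 / a) * x ^ (-a) := by
  have hcont : ContinuousOn (fun y : ℝ => y ^ (-a) / (x + y)) (Ioi 0) := by
    intro y hy
    have hy : 0 < y := hy
    exact ((Real.continuousAt_rpow_const _ _ (Or.inl hy.ne')).div (by fun_prop)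
      (by positivity)).continuousWithinAt
  have hmeas {s : Set ℝ} (hs : s ⊆ Ioi 0) (hsm : MeasurableSet s) :
      AEStronglyMeasurable (fun y : ℝ => y ^ (-a) / (x + y)) (volume.restrict s) :=
    (hcont.mono hs).aestronglyMeasurable hsm
  have hsub : Ioc 0 x ⊆ Ioi (0 : ℝ) := Ioc_subset_Ioi_self
  have hsub' : Ioi x ⊆ Ioi (0 : ℝ) := Ioi_subset_Ioi hx.le
  have hI1 : IntegrableOn (fun y : ℝ => y ^ (-a) / x) (Ioc 0 x) :=
    (((intervalIntegrable_iff_integrableOn_Ioc_of_le hx.le).1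
      (intervalIntegral.intervalIntegrable_rpow' (by linarith))).div_const x)
  have hI2 : IntegrableOn (fun y : ℝ => y ^ (-a - 1)) (Ioi x) :=
    integrableOn_Ioi_rpow_of_lt (by linarith) hx
  have hb1 : ∀ y ∈ Ioc 0 x, y ^ (-a) / (x + y) ≤ y ^ (-a) / x := fun y hy => by
    have := hy.1
    gcongr
    linarith
  have hb2 : ∀ y ∈ Ioi x, y ^ (-a) / (x + y) ≤ y ^ (-a - 1) := fun y hy => by
    have hy' : 0 < y := hx.trans hy
    rw [Real.rpow_sub_one hy'.ne']
    gcongr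
    linarith
  have hnn : ∀ y : ℝ, 0 < y → ‖y ^ (-a) / (x + y)‖ = y ^ (-a) / (x + y) := fun y hy =>
    Real.norm_of_nonneg (by positivity)
  have hJ1 : IntegrableOn (fun y : ℝ => y ^ (-a) / (x + y)) (Ioc 0 x) := by
    refine Integrable.mono' hI1 (hmeas hsub measurableSet_Ioc) ?_
    filter_upwards [ae_restrict_mem measurableSet_Ioc] with y hy
    rw [hnn y hy.1]
    exact hb1 y hy
  have hJ2 : IntegrableOn (fun y : ℝ => y ^ (-a) / (x + y)) (Ioi x) := by
    refine Integrable.mono' hI2 (hmeas hsub' measurableSet_Ioi) ?_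
    filter_upwards [ae_restrict_mem measurableSet_Ioi] with y hy
    rw [hnn y (hsub' hy)]
    exact hb2 y hy
  rw [← Ioc_union_Ioi_eq_Ioi hx.le]
  refine ⟨hJ1.union hJ2, ?_⟩
  rw [setIntegral_union (Ioc_disjoint_Ioi le_rfl) measurableSet_Ioi hJ1 hJ2]
  have h1 := setIntegral_mono_on hJ1 hI1 measurableSet_Ioc hb1
  have h2 := setIntegral_mono_on hJ2 hI2 measurableSet_Ioi hb2
  rw [integral_Ioi_rpow_of_lt (by linarith) hx] at h2
  rw [integral_div, ← intervalIntegral.integral_of_le (f := fun y : ℝ => y ^ (-a)) hx.le,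
    integral_rpow (Or.inl (by linarith)), Real.zero_rpow (by linarith), Real.rpow_add hx,
    Real.rpow_one] at h1
  have e1 : (x ^ (-a) * x - 0) / (-a + 1) / x = 1 / (1 - a) * x ^ (-a) := by
    have : 1 - a ≠ 0 := by linarith
    have : -a + 1 ≠ 0 := by linarith
    field_simp
    ring
  have e2 : -x ^ (-a - 1 + 1) / (-a - 1 + 1) = 1 / a * x ^ (-a) := by
    rw [sub_add_cancel]
    field_simp
  rw [e1] at h1
  rw [e2] at h2
  linarith

/-- The extremal growth profile of the unit ball of `B_{ε,η}`, against the Stieltjes kernel. -/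
def majorant (ε η x y : ℝ) : ℝ :=
  (Ioo (0 : ℝ) 1).indicator (fun y => y ^ (-η) / (x + y)) y +
    (Ioi (1 : ℝ)).indicator (fun y => y ^ (-ε) / (x + y)) y

section

variable {ε η : ℝ}

lemma integrableOn_majorant_and_integral_eq (hε1 : 0 < ε) (hε2 : ε < 1) (hη1 : 0 < η) (hη2 : η < 1) {x : ℝ} (hx : 0 < x) :
    IntegrableOn (majorant ε η x) (Ioi 0) ∧
      ∫ y in Ioi (0 : ℝ), majorant ε η x y =
        (∫ y in Ioo (0 : ℝ) 1, y ^ (-η) / (x + y)) + ∫ y in Ioi (1 : ℝ), y ^ (-ε) / (x + y) := by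
  have h1 := (integrableOn_rpow_neg_div_add hη1 hη2 hx).1.indicator (t := Ioo (0 : ℝ) 1)
    measurableSet_Ioo
  have h2 := (integrableOn_rpow_neg_div_add hε1 hε2 hx).1.indicator (t := Ioi (1 : ℝ))
    measurableSet_Ioi
  refine ⟨h1.add h2, ?_⟩
  unfold majorant
  rw [integral_add h1 h2, setIntegral_indicator measurableSet_Ioo,
    setIntegral_indicator measurableSet_Ioi, inter_eq_right.2 Ioo_subset_Ioi_self,
    inter_eq_right.2 (Ioi_subset_Ioi zero_le_one)]

lemma integral_rpow_neg_div_add_le_of_subset {a x : ℝ} (ha0 : 0 < a) (ha1 : a < 1) (hx : 0 < x)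
    {s : Set ℝ} (hs : s ⊆ Ioi 0) :
    ∫ y in s, y ^ (-a) / (x + y) ≤ (1 / (1 - a) + 1 / a) * x ^ (-a) := by
  obtain ⟨h, h'⟩ := integrableOn_rpow_neg_div_add ha0 ha1 hx
  refine (setIntegral_mono_set h ?_ hs.eventuallyLE).trans h'
  filter_upwards [ae_restrict_mem measurableSet_Ioi] with y hy
  have : (0 : ℝ) < y := hy
  simp only [Pi.zero_apply]
  positivity

lemma integral_Ioo_rpow_neg_div_add_le {a x : ℝ} (ha0 : 0 < a) (ha1 : a < 1) (hx : 0 < x) :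
    ∫ y in Ioo (0 : ℝ) 1, y ^ (-a) / (x + y) ≤ 1 / (1 - a) / x := by
  have hI : IntegrableOn (fun y : ℝ => y ^ (-a) / x) (Ioo 0 1) :=
    ((intervalIntegral.integrableOn_Ioo_rpow_iff zero_lt_one).2 (by linarith)).div_const x
  have h := setIntegral_mono_on
    ((integrableOn_rpow_neg_div_add ha0 ha1 hx).1.mono_set Ioo_subset_Ioi_self) hI
    measurableSet_Ioo (fun y hy => by
      have := hy.1
      show y ^ (-a) / (x + y) ≤ y ^ (-a) / x
      gcongr
      linarith)
  rw [integral_div, ← integral_Ioc_eq_integral_Ioo (f := fun y : ℝ => y ^ (-a)),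
    ← intervalIntegral.integral_of_le (f := fun y : ℝ => y ^ (-a)) zero_le_one, integral_rpow (Or.inl (by linarith)),
    Real.zero_rpow (by linarith), Real.one_rpow, sub_zero, neg_add_eq_sub] at h
  exact h

lemma integral_Ioi_one_rpow_neg_div_add_le {a x : ℝ} (ha0 : 0 < a) (ha1 : a < 1) (hx : 0 < x) :
    ∫ y in Ioi (1 : ℝ), y ^ (-a) / (x + y) ≤ 1 / a := by
  have h := setIntegral_mono_on
    ((integrableOn_rpow_neg_div_add ha0 ha1 hx).1.mono_set (Ioi_subset_Ioi zero_le_one))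
    (integrableOn_Ioi_rpow_of_lt (a := -a - 1) (by linarith) zero_lt_one)
    measurableSet_Ioi (fun y hy => by
      have hy' : 0 < y := zero_lt_one.trans hy
      show y ^ (-a) / (x + y) ≤ y ^ (-a - 1)
      rw [Real.rpow_sub_one hy'.ne']
      gcongr
      linarith)
  rw [integral_Ioi_rpow_of_lt (by linarith) zero_lt_one, Real.one_rpow, sub_add_cancel,
    neg_div_neg_eq] at h
  exact h

lemma norm_div_add (f : ℝ → ℂ) {x y : ℝ} (hx : 0 < x) (hy : 0 < y) :
    ‖f y / ((x : ℂ) + (y : ℂ))‖ = ‖f y‖ / (x + y) := by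
  rw [norm_div, ← Complex.ofReal_add, Complex.norm_of_nonneg (by positivity)]

lemma norm_le_mul_rpow_neg {a y t M : ℝ} (hy : 0 < y) (h : y ^ a * t ≤ M) :
    t ≤ M * y ^ (-a) := by
  rw [Real.rpow_neg hy.le, ← div_eq_mul_inv, le_div_iff₀' (by positivity)]
  exact h

lemma ae_norm_le_majorant {f : ℝ → ℂ} {M : ℝ} (h1 : ∀ x : ℝ, 1 < x → x ^ ε * ‖f x‖ ≤ M)
    (h2 : ∀ x : ℝ, 0 < x → x < 1 → x ^ η * ‖f x‖ ≤ M) :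
    ∀ᵐ y ∂(volume.restrict (Ioi (0 : ℝ))), ∀ x : ℝ, 0 < x →
      ‖f y / ((x : ℂ) + (y : ℂ))‖ ≤ M * majorant ε η x y := by
  have hne : ∀ᵐ y : ℝ, y ≠ 1 := by simp [ae_iff]
  filter_upwards [ae_restrict_mem measurableSet_Ioi, ae_restrict_of_ae hne] with y hy hy1 x hx
  have hy : 0 < y := hy
  rw [norm_div_add f hx hy]
  rcases lt_or_gt_of_ne hy1 with hlt | hgt
  · have : majorant ε η x y = y ^ (-η) / (x + y) := by
      simp [majorant, hy, hlt, hlt.le]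
    rw [this, ← mul_div_assoc]
    gcongr
    exact norm_le_mul_rpow_neg hy (h2 y hy hlt)
  · have : majorant ε η x y = y ^ (-ε) / (x + y) := by
      simp [majorant, hgt, hgt.le]
    rw [this, ← mul_div_assoc]
    gcongr
    exact norm_le_mul_rpow_neg hy (h1 y hgt)

lemma aestronglyMeasurable_div_add {f : ℝ → ℂ} (hf : ContinuousOn f (Ioi 0)) {x : ℝ} (hx : 0 < x) :
    AEStronglyMeasurable (fun y : ℝ => f y / ((x : ℂ) + (y : ℂ)))
      (volume.restrict (Ioi (0 : ℝ))) := by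
  refine ContinuousOn.aestronglyMeasurable (hf.div (by fun_prop) fun y hy => ?_) measurableSet_Ioi
  have hy : 0 < y := hy
  exact_mod_cast (add_pos hx hy).ne'

lemma norm_integral_le {f : ℝ → ℂ} {M x : ℝ} (hε1 : 0 < ε) (hε2 : ε < 1) (hη1 : 0 < η)
    (hη2 : η < 1) (h1 : ∀ x : ℝ, 1 < x → x ^ ε * ‖f x‖ ≤ M)
    (h2 : ∀ x : ℝ, 0 < x → x < 1 → x ^ η * ‖f x‖ ≤ M) (hx : 0 < x) :
    ‖∫ y in Ioi (0 : ℝ), f y / ((x : ℂ) + (y : ℂ))‖ ≤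
      M * ((∫ y in Ioo (0 : ℝ) 1, y ^ (-η) / (x + y)) +
        ∫ y in Ioi (1 : ℝ), y ^ (-ε) / (x + y)) := by
  obtain ⟨hi, he⟩ := integrableOn_majorant_and_integral_eq hε1 hε2 hη1 hη2 hx
  rw [← he, ← integral_const_mul]
  refine norm_integral_le_of_norm_le (hi.const_mul M) ?_
  filter_upwards [ae_norm_le_majorant h1 h2] with y hy using hy x hx

lemma continuousOn_integral {f : ℝ → ℂ} (hε1 : 0 < ε) (hε2 : ε < 1) (hη1 : 0 < η)
    (hη2 : η < 1) (hf : MemB ε η f) :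
    ContinuousOn (fun x : ℝ => ∫ y in Ioi (0 : ℝ), f y / ((x : ℂ) + (y : ℂ))) (Ioi 0) := by
  obtain ⟨hc, M, h1, h2⟩ := hf
  intro x₀ hx₀
  have hx₀ : 0 < x₀ := hx₀
  have hnhds : ∀ᶠ x in nhds x₀, x₀ / 2 < x := lt_mem_nhds (by linarith)
  refine (continuousAt_of_dominated (bound := fun y => M * majorant ε η (x₀ / 2) y) ?_ ?_
    ((integrableOn_majorant_and_integral_eq hε1 hε2 hη1 hη2 (half_pos hx₀)).1.const_mul M) ?_).continuousWithinAt
  · filter_upwards [hnhds] with x hx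
    exact aestronglyMeasurable_div_add hc (by linarith)
  · filter_upwards [hnhds] with x hx
    filter_upwards [ae_norm_le_majorant h1 h2, ae_restrict_mem measurableSet_Ioi] with y hb hy
    have hy : 0 < y := hy
    refine le_trans ?_ (hb (x₀ / 2) (half_pos hx₀))
    rw [norm_div_add f (by linarith) hy, norm_div_add f (by linarith) hy]
    gcongr
  · filter_upwards [ae_restrict_mem measurableSet_Ioi] with y hy
    have hy : 0 < y := hy
    refine ContinuousAt.div (by fun_prop) (by fun_prop) ?_
    exact_mod_cast (add_pos hx₀ hy).ne'

lemma rpow_mul_norm_integral_le {f : ℝ → ℂ} {M : ℝ} (hε1 : 0 < ε) (hε2 : ε < 1) (hη1 : 0 < η)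
    (hη2 : η < 1) (hM : 0 ≤ M) (h1 : ∀ x : ℝ, 1 < x → x ^ ε * ‖f x‖ ≤ M)
    (h2 : ∀ x : ℝ, 0 < x → x < 1 → x ^ η * ‖f x‖ ≤ M) :
    (∀ x : ℝ, 1 < x → x ^ ε * ‖∫ y in Ioi (0 : ℝ), f y / ((x : ℂ) + (y : ℂ))‖ ≤
      (1 / (1 - η) + (1 / (1 - ε) + 1 / ε)) * M) ∧
    ∀ x : ℝ, 0 < x → x < 1 → x ^ η * ‖∫ y in Ioi (0 : ℝ), f y / ((x : ℂ) + (y : ℂ))‖ ≤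
      (1 / (1 - η) + 1 / η + 1 / ε) * M := by
  constructor
  · intro x hx
    have hx0 : 0 < x := zero_lt_one.trans hx
    have hA := integral_Ioo_rpow_neg_div_add_le hη1 hη2 hx0
    have hB := integral_rpow_neg_div_add_le_of_subset hε1 hε2 hx0 (Ioi_subset_Ioi zero_le_one)
    have hp : x ^ ε ≤ x := by simpa using Real.rpow_le_rpow_of_exponent_le hx.le hε2.le
    have hpos : 0 < 1 - η := by linarith
    have hq : x ^ ε * (1 / (1 - η) / x) ≤ 1 / (1 - η) := by
      calc x ^ ε * (1 / (1 - η) / x) ≤ x * (1 / (1 - η) / x) := by gcongr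
        _ = 1 / (1 - η) := by field_simp
    have hr : x ^ ε * x ^ (-ε) = 1 := by rw [← Real.rpow_add hx0]; simp
    calc _ ≤ x ^ ε * (M * (1 / (1 - η) / x + (1 / (1 - ε) + 1 / ε) * x ^ (-ε))) := by
          refine mul_le_mul_of_nonneg_left ?_ (by positivity)
          exact (norm_integral_le hε1 hε2 hη1 hη2 h1 h2 hx0).trans (by gcongr)
      _ = (x ^ ε * (1 / (1 - η) / x) + (1 / (1 - ε) + 1 / ε) * (x ^ ε * x ^ (-ε))) * M := by ring
      _ ≤ _ := by
          rw [hr, mul_one]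
          gcongr
  · intro x hx0 hx
    have hA := integral_rpow_neg_div_add_le_of_subset hη1 hη2 hx0
      (s := Ioo 0 1) Ioo_subset_Ioi_self
    have hB := integral_Ioi_one_rpow_neg_div_add_le hε1 hε2 hx0
    have hp : x ^ η ≤ 1 := Real.rpow_le_one hx0.le hx.le hη1.le
    have hq : x ^ η * (1 / ε) ≤ 1 / ε := mul_le_of_le_one_left (by positivity) hp
    have hr : x ^ η * x ^ (-η) = 1 := by rw [← Real.rpow_add hx0]; simp
    calc _ ≤ x ^ η * (M * ((1 / (1 - η) + 1 / η) * x ^ (-η) + 1 / ε)) := by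
          refine mul_le_mul_of_nonneg_left ?_ (by positivity)
          exact (norm_integral_le hε1 hε2 hη1 hη2 h1 h2 hx0).trans (by gcongr)
      _ = ((1 / (1 - η) + 1 / η) * (x ^ η * x ^ (-η)) + x ^ η * (1 / ε)) * M := by ring
      _ ≤ _ := by
          rw [hr, mul_one]
          gcongr

lemma Bnorm_nonneg (ε η : ℝ) (f : ℝ → ℂ) : 0 ≤ Bnorm ε η f := by
  refine add_nonneg (Real.sSup_nonneg ?_) (Real.sSup_nonneg ?_)
  · rintro _ ⟨x, hx, rfl⟩
    have : (0 : ℝ) < x := zero_lt_one.trans hx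
    positivity
  · rintro _ ⟨x, hx, rfl⟩
    have := hx.1
    positivity

lemma le_Bnorm {f : ℝ → ℂ} (hf : MemB ε η f) :
    (∀ x : ℝ, 1 < x → x ^ ε * ‖f x‖ ≤ Bnorm ε η f) ∧
      ∀ x : ℝ, 0 < x → x < 1 → x ^ η * ‖f x‖ ≤ Bnorm ε η f := by
  obtain ⟨-, M, h1, h2⟩ := hf
  have b1 : BddAbove ((fun x : ℝ => x ^ ε * ‖f x‖) '' Ioi 1) :=
    ⟨M, by rintro _ ⟨x, hx, rfl⟩; exact h1 x hx⟩
  have b2 : BddAbove ((fun x : ℝ => x ^ η * ‖f x‖) '' Ioo 0 1) :=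
    ⟨M, by rintro _ ⟨x, hx, rfl⟩; exact h2 x hx.1 hx.2⟩
  constructor
  · intro x hx
    refine (le_csSup b1 ⟨x, hx, rfl⟩).trans (le_add_of_nonneg_right (Real.sSup_nonneg ?_))
    rintro _ ⟨z, hz, rfl⟩
    have := hz.1
    positivity
  · intro x hx0 hx
    refine (le_csSup b2 ⟨x, ⟨hx0, hx⟩, rfl⟩).trans (le_add_of_nonneg_left (Real.sSup_nonneg ?_))
    rintro _ ⟨z, hz, rfl⟩
    have : (0 : ℝ) < z := zero_lt_one.trans hz
    positivity

lemma Bnorm_le {f : ℝ → ℂ} {M N : ℝ} (h1 : ∀ x : ℝ, 1 < x → x ^ ε * ‖f x‖ ≤ M)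
    (h2 : ∀ x : ℝ, 0 < x → x < 1 → x ^ η * ‖f x‖ ≤ N) : Bnorm ε η f ≤ M + N := by
  refine add_le_add (csSup_le (nonempty_Ioi.image _) ?_)
    (csSup_le ((nonempty_Ioo.2 zero_lt_one).image _) ?_)
  · rintro _ ⟨x, hx, rfl⟩
    exact h1 x hx
  · rintro _ ⟨x, hx, rfl⟩
    exact h2 x hx.1 hx.2

end

end Stieltjes

open Stieltjes

/-- Proposition 3: for `0 < ε, η < 1`, the Stieltjes operator `S`
maps `B_{ε,η}` into itself, is well defined (absolutely convergent integral),
produces continuous functions, and is bounded. -/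
theorem stmt15 (ε η : ℝ) (hε1 : 0 < ε) (hε2 : ε < 1) (hη1 : 0 < η) (hη2 : η < 1) :
    (∀ f : ℝ → ℂ, MemB ε η f →
      (∀ x : ℝ, 0 < x → IntegrableOn (fun y : ℝ => f y / ((x : ℂ) + (y : ℂ))) (Ioi 0)) ∧
      ContinuousOn (fun x : ℝ => ∫ y in Ioi (0 : ℝ), f y / ((x : ℂ) + (y : ℂ))) (Ioi 0) ∧
      MemB ε η (fun x : ℝ => ∫ y in Ioi (0 : ℝ), f y / ((x : ℂ) + (y : ℂ)))) ∧
    ∃ C : ℝ, 0 < C ∧ ∀ f : ℝ → ℂ, MemB ε η f →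
      Bnorm ε η (fun x : ℝ => ∫ y in Ioi (0 : ℝ), f y / ((x : ℂ) + (y : ℂ))) ≤
        C * Bnorm ε η f := by
  have hη : 0 < 1 - η := by linarith
  have hε : 0 < 1 - ε := by linarith
  refine ⟨fun f hf => ⟨fun x hx => ?_, continuousOn_integral hε1 hε2 hη1 hη2 hf,
    continuousOn_integral hε1 hε2 hη1 hη2 hf, ?_⟩,
    (1 / (1 - η) + (1 / (1 - ε) + 1 / ε)) + (1 / (1 - η) + 1 / η + 1 / ε), by positivity,
    fun f hf => ?_⟩
  · obtain ⟨hc, M, h1, h2⟩ := hf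
    refine Integrable.mono' ((integrableOn_majorant_and_integral_eq hε1 hε2 hη1 hη2 hx).1.const_mul M)
      (aestronglyMeasurable_div_add hc hx) ?_
    filter_upwards [ae_norm_le_majorant h1 h2] with y hy using hy x hx
  · obtain ⟨h1, h2⟩ := le_Bnorm hf
    obtain ⟨k1, k2⟩ := rpow_mul_norm_integral_le hε1 hε2 hη1 hη2 (Bnorm_nonneg ε η f) h1 h2
    exact ⟨_, fun x hx => (k1 x hx).trans (le_max_left _ _),
      fun x hx0 hx => (k2 x hx0 hx).trans (le_max_right _ _)⟩
  · obtain ⟨h1, h2⟩ := le_Bnorm hf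
    obtain ⟨k1, k2⟩ := rpow_mul_norm_integral_le hε1 hε2 hη1 hη2 (Bnorm_nonneg ε η f) h1 h2
    rw [add_mul]
    exact Bnorm_le k1 k2

end
end

section
/- (Proposition 4) Let β ∈ ℂ with -1 < Re β < 2, and let ε, η satisfy max(0, Re β − 1) < ε, η < min(1, Re β + 1). For f ∈ B_{ε,η} define (T^{β} f)(x) = x·∫₀^∞ ((y/x)^{β} − 1)/(y² − x²)·f(y) dy for x > 0, where the integrand is extended continuously across y = x. Then this integral is absolutely convergent for every x > 0, T^{β} f ∈ B_{ε,η}, and there exists a constant C = C(β,ε,η) > 0, independent of f, such that ‖T^{β} f‖_{ε,η} ≤ C·‖f‖_{ε,η}. -/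
open MeasureTheory Set Asymptotics

noncomputable section

/-- the kernel of the operator `T^β`, i.e. `((y/x)^β − 1)/(y² − x²)` extended
continuously across `y = x`. -/
def tker (β : ℂ) (x y : ℝ) : ℂ :=
  if y = x then β / (2 * (x : ℂ) ^ 2)
  else (((y / x : ℝ) : ℂ) ^ β - 1) / ((y : ℂ) ^ 2 - (x : ℂ) ^ 2)

theorem hasDerivAt_ofReal_cpow_const_of_pos (β : ℂ) {x : ℝ} (hx : 0 < x) :
    HasDerivAt (fun u : ℝ => (u : ℂ) ^ β) (β * (x : ℂ) ^ (β - 1)) x := by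
  simpa using ((hasDerivAt_id (x : ℂ)).cpow_const (c := β)
    (Complex.ofReal_mem_slitPlane.2 hx)).comp_ofReal

theorem tker_eq_dslope (β : ℂ) {t : ℝ} (ht : 0 < t) :
    tker β 1 t = dslope (fun u : ℝ => (u : ℂ) ^ β) 1 t / ((t : ℂ) + 1) := by
  have h1 : (t : ℂ) + 1 ≠ 0 := by
    have : t + 1 ≠ 0 := by positivity
    exact_mod_cast this
  by_cases h : t = 1
  · subst h
    simp only [tker, dslope_same, (hasDerivAt_ofReal_cpow_const_of_pos β one_pos).deriv]
    norm_num
  · have h2 : (t : ℂ) - 1 ≠ 0 := by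
      rw [sub_ne_zero]; exact_mod_cast h
    have h3 : (t : ℂ) ^ 2 - 1 ≠ 0 := by
      have : (t : ℂ) ^ 2 - 1 = (t - 1) * (t + 1) := by ring
      rw [this]; exact mul_ne_zero h2 h1
    rw [dslope_of_ne _ h, slope_def_module]
    simp only [tker, h, if_false, div_one, Complex.real_smul, Complex.ofReal_one,
      Complex.one_cpow, one_pow]
    push_cast
    field_simp
    ring

theorem continuousOn_tker_one (β : ℂ) : ContinuousOn (tker β 1) (Ioi 0) := by
  have hd : ∀ x ∈ Ioi (0 : ℝ), DifferentiableAt ℝ (fun u : ℝ => (u : ℂ) ^ β) x :=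
    fun x hx => (hasDerivAt_ofReal_cpow_const_of_pos β hx).differentiableAt
  have hc : ContinuousOn (dslope (fun u : ℝ => (u : ℂ) ^ β) 1) (Ioi 0) :=
    (continuousOn_dslope (Ioi_mem_nhds one_pos)).2
      ⟨fun x hx => (hd x hx).continuousAt.continuousWithinAt, hd 1 (mem_Ioi.2 one_pos)⟩
  refine ContinuousOn.congr (f := fun t : ℝ => dslope (fun u : ℝ => (u : ℂ) ^ β) 1 t /
    ((t : ℂ) + 1)) (hc.div (by fun_prop) ?_) fun t ht => tker_eq_dslope β ht
  intro t ht
  have : t + 1 ≠ 0 := by have : 0 < t := ht; positivity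
  exact_mod_cast this

theorem norm_tker_one_le (β : ℂ) {t : ℝ} (ht : 0 < t) {d : ℝ} (hd : 0 < d)
    (h : d ≤ |t ^ 2 - 1|) : ‖tker β 1 t‖ ≤ (t ^ β.re + 1) / d := by
  have hne : t ≠ 1 := by
    rintro rfl
    norm_num at h
    linarith
  have hden : ‖(t : ℂ) ^ 2 - ((1 : ℝ) : ℂ) ^ 2‖ = |t ^ 2 - 1| := by
    rw [← Real.norm_eq_abs, ← Complex.norm_real]
    push_cast
    simp
  simp only [tker, hne, if_false, norm_div, div_one]
  rw [hden]
  have hnum : ‖(t : ℂ) ^ β - 1‖ ≤ t ^ β.re + 1 := by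
    refine (norm_sub_le _ _).trans ?_
    rw [Complex.norm_cpow_eq_rpow_re_of_pos ht, norm_one]
  gcongr

theorem integrableOn_norm_tker_one_mul_rpow (β : ℂ) {s : ℝ} (h0 : 0 < s) (h1 : s < 1)
    (hl : β.re - 1 < s) (hu : s < β.re + 1) :
    IntegrableOn (fun t : ℝ => ‖tker β 1 t‖ * t ^ (-s)) (Ioi 0) := by
  have hc : ContinuousOn (fun t : ℝ => ‖tker β 1 t‖ * t ^ (-s)) (Ioi 0) :=
    (continuousOn_tker_one β).norm.mul
      (continuousOn_id.rpow_const fun x hx => Or.inl (ne_of_gt hx))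
  have hU : Ioi (0 : ℝ) = (Ioc 0 (1 / 2) ∪ Icc (1 / 2) 2) ∪ Ioi 2 := by
    ext x
    simp only [mem_Ioi, mem_union, mem_Ioc, mem_Icc]
    constructor
    · intro hx
      rcases le_total x (1 / 2) with h | h
      · exact Or.inl (Or.inl ⟨hx, h⟩)
      · rcases le_or_gt x 2 with h' | h'
        · exact Or.inl (Or.inr ⟨h, h'⟩)
        · exact Or.inr h'
    · rintro ((⟨h, -⟩ | ⟨h, -⟩) | h) <;> linarith
  have hsub1 : Ioc (0 : ℝ) (1 / 2) ⊆ Ioi 0 := Ioc_subset_Ioi_self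
  have hsub2 : Icc (1 / 2 : ℝ) 2 ⊆ Ioi 0 := fun x hx => lt_of_lt_of_le (by norm_num) hx.1
  have hsub3 : Ioi (2 : ℝ) ⊆ Ioi 0 := Ioi_subset_Ioi (by norm_num)
  rw [hU]
  refine IntegrableOn.union (IntegrableOn.union ?_ ?_) ?_
  · have hg : IntegrableOn (fun t : ℝ => 2 * (t ^ (β.re - s) + t ^ (-s))) (Ioc 0 (1 / 2)) := by
      have a := intervalIntegral.intervalIntegrable_rpow' (a := 0) (b := 1 / 2)
        (r := β.re - s) (by linarith)
      have b := intervalIntegral.intervalIntegrable_rpow' (a := 0) (b := 1 / 2)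
        (r := -s) (by linarith)
      rw [intervalIntegrable_iff_integrableOn_Ioc_of_le (by norm_num)] at a b
      exact (a.add b).const_mul 2
    refine hg.mono' ((hc.mono hsub1).aestronglyMeasurable measurableSet_Ioc) ?_
    filter_upwards [ae_restrict_mem measurableSet_Ioc] with t ht
    obtain ⟨ht0, ht1⟩ := ht
    have hd : (1 / 2 : ℝ) ≤ |t ^ 2 - 1| := by
      rw [abs_of_nonpos (by nlinarith)]; nlinarith
    have hk := norm_tker_one_le β ht0 (by norm_num) hd
    rw [Real.norm_of_nonneg (by positivity), sub_eq_add_neg, Real.rpow_add ht0]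
    calc ‖tker β 1 t‖ * t ^ (-s) ≤ (t ^ β.re + 1) / (1 / 2) * t ^ (-s) := by gcongr
      _ = _ := by ring
  · exact (hc.mono hsub2).integrableOn_compact isCompact_Icc
  · have hg : IntegrableOn (fun t : ℝ => 2 * (t ^ (β.re + -s - 2) + t ^ (-s - 2))) (Ioi 2) :=
      ((integrableOn_Ioi_rpow_of_lt (by linarith) (by norm_num)).add
        (integrableOn_Ioi_rpow_of_lt (by linarith) (by norm_num))).const_mul 2
    refine hg.mono' ((hc.mono hsub3).aestronglyMeasurable measurableSet_Ioi) ?_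
    filter_upwards [ae_restrict_mem measurableSet_Ioi] with t ht
    have ht2 : 2 < t := ht
    have ht0 : 0 < t := by linarith
    have hd : t ^ 2 / 2 ≤ |t ^ 2 - 1| := by
      rw [abs_of_nonneg (by nlinarith)]; nlinarith
    have hk := norm_tker_one_le β ht0 (by positivity) hd
    rw [Real.norm_of_nonneg (by positivity), Real.rpow_sub ht0, Real.rpow_sub ht0,
      Real.rpow_add ht0, Real.rpow_two]
    calc ‖tker β 1 t‖ * t ^ (-s) ≤ (t ^ β.re + 1) / (t ^ 2 / 2) * t ^ (-s) := by gcongr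
      _ = _ := by field_simp

theorem tker_mul_left (β : ℂ) {x : ℝ} (hx : 0 < x) (t : ℝ) :
    tker β x (x * t) = tker β 1 t / (x : ℂ) ^ 2 := by
  have hxc : (x : ℂ) ≠ 0 := by exact_mod_cast hx.ne'
  by_cases h : t = 1
  · subst h
    simp only [tker, mul_one, if_true]
    push_cast
    field_simp
  · have h' : x * t ≠ x := by
      intro h2
      exact h (mul_left_cancel₀ hx.ne' (by linarith))
    simp only [tker, h, h', if_false, mul_div_cancel_left₀ t hx.ne', div_one]
    have : ((x * t : ℝ) : ℂ) ^ 2 - (x : ℂ) ^ 2 = ((t : ℂ) ^ 2 - ((1 : ℝ) : ℂ) ^ 2) * (x : ℂ) ^ 2 := by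
      push_cast; ring
    rw [this, div_div]

theorem mul_integral_tker (β : ℂ) (f : ℝ → ℂ) {x : ℝ} (hx : 0 < x) :
    (x : ℂ) * ∫ y in Ioi (0 : ℝ), tker β x y * f y =
      ∫ t in Ioi (0 : ℝ), tker β 1 t * f (x * t) := by
  have hxc : (x : ℂ) ≠ 0 := by exact_mod_cast hx.ne'
  have h := integral_comp_mul_left_Ioi (fun y => tker β x y * f y) 0 hx
  simp only [mul_zero] at h
  have h2 : ∫ y in Ioi (0 : ℝ), tker β x y * f y =
      (x : ℂ) * ∫ t in Ioi (0 : ℝ), tker β x (x * t) * f (x * t) := by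
    rw [h, Complex.real_smul]
    push_cast
    field_simp
  rw [h2, ← mul_assoc, ← integral_const_mul]
  congr 1
  ext t
  rw [tker_mul_left β hx]
  field_simp

section

variable {ε η : ℝ} {f : ℝ → ℂ}

theorem MemB.bddAbove_Ioi (hf : MemB ε η f) :
    BddAbove ((fun x : ℝ => x ^ ε * ‖f x‖) '' Ioi 1) := by
  obtain ⟨-, M, h, -⟩ := hf
  exact ⟨M, by rintro _ ⟨x, hx, rfl⟩; exact h x hx⟩

theorem MemB.bddAbove_Ioo (hf : MemB ε η f) :
    BddAbove ((fun x : ℝ => x ^ η * ‖f x‖) '' Ioo 0 1) := by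
  obtain ⟨-, M, -, h⟩ := hf
  exact ⟨M, by rintro _ ⟨x, hx, rfl⟩; exact h x hx.1 hx.2⟩

theorem sSup_image_Ioi_nonneg : 0 ≤ sSup ((fun x : ℝ => x ^ ε * ‖f x‖) '' Ioi 1) := by
  refine Real.sSup_nonneg ?_
  rintro _ ⟨x, hx, rfl⟩
  have : 0 < x := one_pos.trans hx
  positivity

theorem sSup_image_Ioo_nonneg : 0 ≤ sSup ((fun x : ℝ => x ^ η * ‖f x‖) '' Ioo 0 1) := by
  refine Real.sSup_nonneg ?_
  rintro _ ⟨x, hx, rfl⟩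
  have : 0 < x := hx.1
  positivity

theorem Bnorm_nonneg : 0 ≤ Bnorm ε η f :=
  add_nonneg sSup_image_Ioi_nonneg sSup_image_Ioo_nonneg

theorem MemB.rpow_mul_norm_le_of_one_lt (hf : MemB ε η f) {x : ℝ} (hx : 1 < x) :
    x ^ ε * ‖f x‖ ≤ Bnorm ε η f :=
  (le_csSup hf.bddAbove_Ioi ⟨x, hx, rfl⟩).trans (le_add_of_nonneg_right sSup_image_Ioo_nonneg)

theorem MemB.rpow_mul_norm_le_of_lt_one (hf : MemB ε η f) {x : ℝ} (h0 : 0 < x) (hx : x < 1) :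
    x ^ η * ‖f x‖ ≤ Bnorm ε η f :=
  (le_csSup hf.bddAbove_Ioo ⟨x, ⟨h0, hx⟩, rfl⟩).trans
    (le_add_of_nonneg_left sSup_image_Ioi_nonneg)

theorem MemB.norm_one_le (hf : MemB ε η f) : ‖f 1‖ ≤ Bnorm ε η f := by
  have hc : ContinuousAt (fun x : ℝ => x ^ ε * ‖f x‖) 1 :=
    (Real.continuousAt_rpow_const 1 ε (Or.inl one_ne_zero)).mul
      (hf.1.continuousAt (Ioi_mem_nhds one_pos)).norm
  have ht := hc.tendsto.mono_left (nhdsWithin_le_nhds (s := Ioi 1))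
  simp only [Real.one_rpow, one_mul] at ht
  refine le_of_tendsto ht ?_
  filter_upwards [self_mem_nhdsWithin] with x hx using hf.rpow_mul_norm_le_of_one_lt hx

theorem MemB.norm_le_of_one_le (hf : MemB ε η f) {x : ℝ} (hx : 1 ≤ x) :
    ‖f x‖ ≤ Bnorm ε η f * x ^ (-ε) := by
  rcases hx.eq_or_lt with rfl | hx
  · simpa using hf.norm_one_le
  · have h0 : 0 < x := by linarith
    rw [Real.rpow_neg h0.le, ← div_eq_mul_inv, le_div_iff₀ (by positivity), mul_comm]
    exact hf.rpow_mul_norm_le_of_one_lt hx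

theorem MemB.norm_le_of_le_one (hf : MemB ε η f) {x : ℝ} (h0 : 0 < x) (hx : x ≤ 1) :
    ‖f x‖ ≤ Bnorm ε η f * x ^ (-η) := by
  rcases hx.eq_or_lt with rfl | hx
  · simpa using hf.norm_one_le
  · rw [Real.rpow_neg h0.le, ← div_eq_mul_inv, le_div_iff₀ (by positivity), mul_comm]
    exact hf.rpow_mul_norm_le_of_lt_one h0 hx

theorem MemB.norm_le (hf : MemB ε η f) {x : ℝ} (h0 : 0 < x) :
    ‖f x‖ ≤ Bnorm ε η f * (x ^ (-ε) + x ^ (-η)) := by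
  have hN : 0 ≤ Bnorm ε η f := Bnorm_nonneg
  rcases le_total 1 x with h | h
  · refine (hf.norm_le_of_one_le h).trans ?_
    gcongr
    exact le_add_of_nonneg_right (by positivity)
  · refine (hf.norm_le_of_le_one h0 h).trans ?_
    gcongr
    exact le_add_of_nonneg_left (by positivity)

theorem MemB.rpow_mul_norm_comp_mul_le_of_one_lt (hf : MemB ε η f) {x t : ℝ} (hx : 1 < x)
    (ht : 0 < t) :
    x ^ ε * ‖f (x * t)‖ ≤ Bnorm ε η f * (t ^ (-ε) + t ^ (-η)) := by
  have hN : 0 ≤ Bnorm ε η f := Bnorm_nonneg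
  have h0 : 0 < x := by linarith
  have hxt : 0 < x * t := by positivity
  have hpe : 0 ≤ t ^ (-ε) := by positivity
  have hpn : 0 ≤ t ^ (-η) := by positivity
  have hee : x ^ ε * (x * t) ^ (-ε) = t ^ (-ε) := by
    rw [Real.mul_rpow h0.le ht.le, ← mul_assoc, ← Real.rpow_add h0]; simp
  have key : ∀ w : ℝ, ‖f (x * t)‖ ≤ Bnorm ε η f * w → x ^ ε * w ≤ t ^ (-ε) + t ^ (-η) →
      x ^ ε * ‖f (x * t)‖ ≤ Bnorm ε η f * (t ^ (-ε) + t ^ (-η)) := by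
    intro w h1 h2
    calc x ^ ε * ‖f (x * t)‖ ≤ x ^ ε * (Bnorm ε η f * w) := by gcongr
      _ = Bnorm ε η f * (x ^ ε * w) := by ring
      _ ≤ _ := by gcongr
  rcases le_total 1 (x * t) with h | h
  · exact key _ (hf.norm_le_of_one_le h) (by linarith)
  · refine key _ (hf.norm_le_of_le_one hxt h) ?_
    rcases le_total ε η with hle | hle
    · have : x ^ ε * (x * t) ^ (-η) ≤ t ^ (-η) := by
        rw [Real.mul_rpow h0.le ht.le, ← mul_assoc, ← Real.rpow_add h0]
        exact mul_le_of_le_one_left hpn (Real.rpow_le_one_of_one_le_of_nonpos hx.le (by linarith))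
      linarith
    · have : (x * t) ^ (-η) ≤ (x * t) ^ (-ε) :=
        Real.rpow_le_rpow_of_exponent_ge hxt h (by linarith)
      have : x ^ ε * (x * t) ^ (-η) ≤ x ^ ε * (x * t) ^ (-ε) := by gcongr
      linarith

theorem MemB.rpow_mul_norm_comp_mul_le_of_lt_one (hf : MemB ε η f) {x t : ℝ} (h0 : 0 < x)
    (hx : x < 1) (ht : 0 < t) :
    x ^ η * ‖f (x * t)‖ ≤ Bnorm ε η f * (t ^ (-ε) + t ^ (-η)) := by
  have hN : 0 ≤ Bnorm ε η f := Bnorm_nonneg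
  have hxt : 0 < x * t := by positivity
  have hpe : 0 ≤ t ^ (-ε) := by positivity
  have hpn : 0 ≤ t ^ (-η) := by positivity
  have hee : x ^ η * (x * t) ^ (-η) = t ^ (-η) := by
    rw [Real.mul_rpow h0.le ht.le, ← mul_assoc, ← Real.rpow_add h0]; simp
  have key : ∀ w : ℝ, ‖f (x * t)‖ ≤ Bnorm ε η f * w → x ^ η * w ≤ t ^ (-ε) + t ^ (-η) →
      x ^ η * ‖f (x * t)‖ ≤ Bnorm ε η f * (t ^ (-ε) + t ^ (-η)) := by
    intro w h1 h2
    calc x ^ η * ‖f (x * t)‖ ≤ x ^ η * (Bnorm ε η f * w) := by gcongr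
      _ = Bnorm ε η f * (x ^ η * w) := by ring
      _ ≤ _ := by gcongr
  rcases le_total (x * t) 1 with h | h
  · exact key _ (hf.norm_le_of_le_one hxt h) (by linarith)
  · refine key _ (hf.norm_le_of_one_le h) ?_
    rcases le_total ε η with hle | hle
    · have : x ^ η * (x * t) ^ (-ε) ≤ t ^ (-ε) := by
        rw [Real.mul_rpow h0.le ht.le, ← mul_assoc, ← Real.rpow_add h0]
        exact mul_le_of_le_one_left hpe (Real.rpow_le_one h0.le hx.le (by linarith))
      linarith
    · have : (x * t) ^ (-ε) ≤ (x * t) ^ (-η) :=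
        Real.rpow_le_rpow_of_exponent_le h (by linarith)
      have : x ^ η * (x * t) ^ (-ε) ≤ x ^ η * (x * t) ^ (-η) := by gcongr
      linarith

theorem MemB.continuousOn_tker_one_mul_comp (hf : MemB ε η f) (β : ℂ) {x : ℝ} (hx : 0 < x) :
    ContinuousOn (fun t : ℝ => tker β 1 t * f (x * t)) (Ioi 0) :=
  (continuousOn_tker_one β).mul
    (hf.1.comp (by fun_prop) fun _ ht => mul_pos hx ht)

theorem MemB.integrableOn_tker_one_mul_comp (hf : MemB ε η f) {β : ℂ}
    (hE : IntegrableOn (fun t : ℝ => ‖tker β 1 t‖ * t ^ (-ε)) (Ioi 0))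
    (hH : IntegrableOn (fun t : ℝ => ‖tker β 1 t‖ * t ^ (-η)) (Ioi 0)) {x : ℝ} (hx : 0 < x) :
    IntegrableOn (fun t : ℝ => tker β 1 t * f (x * t)) (Ioi 0) := by
  refine (((hE.const_mul (x ^ (-ε))).add (hH.const_mul (x ^ (-η)))).const_mul
    (Bnorm ε η f)).mono'
    ((hf.continuousOn_tker_one_mul_comp β hx).aestronglyMeasurable measurableSet_Ioi) ?_
  filter_upwards [ae_restrict_mem measurableSet_Ioi] with t ht
  have ht : 0 < t := ht
  have h := hf.norm_le (mul_pos hx ht)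
  rw [Real.mul_rpow hx.le ht.le, Real.mul_rpow hx.le ht.le] at h
  rw [norm_mul]
  calc ‖tker β 1 t‖ * ‖f (x * t)‖ ≤ ‖tker β 1 t‖ *
        (Bnorm ε η f * (x ^ (-ε) * t ^ (-ε) + x ^ (-η) * t ^ (-η))) := by gcongr
    _ = _ := by simp only [Pi.add_apply]; ring

theorem MemB.continuousOn_integral_tker_one (hf : MemB ε η f) {β : ℂ} (h0ε : 0 ≤ ε)
    (h0η : 0 ≤ η) (hE : IntegrableOn (fun t : ℝ => ‖tker β 1 t‖ * t ^ (-ε)) (Ioi 0))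
    (hH : IntegrableOn (fun t : ℝ => ‖tker β 1 t‖ * t ^ (-η)) (Ioi 0)) :
    ContinuousOn (fun x : ℝ => ∫ t in Ioi (0 : ℝ), tker β 1 t * f (x * t)) (Ioi 0) := by
  intro a ha
  have ha : 0 < a := ha
  refine ContinuousAt.continuousWithinAt ?_
  refine continuousAt_of_dominated (bound := fun t => Bnorm ε η f *
    ((a / 2) ^ (-ε) * (‖tker β 1 t‖ * t ^ (-ε)) + (a / 2) ^ (-η) * (‖tker β 1 t‖ * t ^ (-η))))
    ?_ ?_ (((hE.const_mul _).add (hH.const_mul _)).const_mul _) ?_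
  · filter_upwards [Ioi_mem_nhds ha] with x hx
    exact (hf.continuousOn_tker_one_mul_comp β hx).aestronglyMeasurable measurableSet_Ioi
  · filter_upwards [Ioi_mem_nhds (half_lt_self ha)] with x hx
    have hax : a / 2 ≤ x := le_of_lt hx
    have hx : 0 < x := by linarith
    filter_upwards [ae_restrict_mem measurableSet_Ioi] with t ht
    have ht : 0 < t := ht
    have hN : 0 ≤ Bnorm ε η f := Bnorm_nonneg
    have h := hf.norm_le (mul_pos hx ht)
    rw [Real.mul_rpow hx.le ht.le, Real.mul_rpow hx.le ht.le] at h
    have e1 : x ^ (-ε) ≤ (a / 2) ^ (-ε) :=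
      Real.rpow_le_rpow_of_nonpos (by positivity) hax (by linarith)
    have e2 : x ^ (-η) ≤ (a / 2) ^ (-η) :=
      Real.rpow_le_rpow_of_nonpos (by positivity) hax (by linarith)
    rw [norm_mul]
    calc ‖tker β 1 t‖ * ‖f (x * t)‖ ≤ ‖tker β 1 t‖ *
          (Bnorm ε η f * (x ^ (-ε) * t ^ (-ε) + x ^ (-η) * t ^ (-η))) := by gcongr
      _ ≤ ‖tker β 1 t‖ * (Bnorm ε η f *
          ((a / 2) ^ (-ε) * t ^ (-ε) + (a / 2) ^ (-η) * t ^ (-η))) := by gcongr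
      _ = _ := by ring
  · filter_upwards [ae_restrict_mem measurableSet_Ioi] with t ht
    refine continuousAt_const.mul (ContinuousAt.comp (f := fun x : ℝ => x * t) ?_ (by fun_prop))
    exact hf.1.continuousAt (Ioi_mem_nhds (mul_pos ha ht))

theorem mul_norm_integral_tker_one_le {β : ℂ} {w x N : ℝ} (hw : 0 ≤ w)
    (hb : ∀ t : ℝ, 0 < t → w * ‖f (x * t)‖ ≤ N * (t ^ (-ε) + t ^ (-η)))
    (hE : IntegrableOn (fun t : ℝ => ‖tker β 1 t‖ * t ^ (-ε)) (Ioi 0))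
    (hH : IntegrableOn (fun t : ℝ => ‖tker β 1 t‖ * t ^ (-η)) (Ioi 0)) :
    w * ‖∫ t in Ioi (0 : ℝ), tker β 1 t * f (x * t)‖ ≤
      (∫ t in Ioi (0 : ℝ), (‖tker β 1 t‖ * t ^ (-ε) + ‖tker β 1 t‖ * t ^ (-η))) * N := by
  rw [← integral_mul_const]
  have : w * ‖∫ t in Ioi (0 : ℝ), tker β 1 t * f (x * t)‖ =
      ‖∫ t in Ioi (0 : ℝ), (w : ℂ) * (tker β 1 t * f (x * t))‖ := by
    rw [integral_const_mul, norm_mul, Complex.norm_real, Real.norm_of_nonneg hw]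
  rw [this]
  refine norm_integral_le_of_norm_le ((hE.add hH).mul_const N) ?_
  filter_upwards [ae_restrict_mem measurableSet_Ioi] with t ht
  rw [norm_mul, norm_mul, Complex.norm_real, Real.norm_of_nonneg hw]
  calc w * (‖tker β 1 t‖ * ‖f (x * t)‖) = ‖tker β 1 t‖ * (w * ‖f (x * t)‖) := by ring
    _ ≤ ‖tker β 1 t‖ * (N * (t ^ (-ε) + t ^ (-η))) := by
      exact mul_le_mul_of_nonneg_left (hb t ht) (norm_nonneg _)
    _ = _ := by ring

end

/-- Proposition 4, Atkinson: for `-1 < Re β < 2` and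
`max(0, Re β - 1) < ε, η < min(1, Re β + 1)`, the operator
`(T^β f)(x) = x ∫₀^∞ ((y/x)^β − 1)/(y² − x²) f(y) dy` is a bounded linear
operator from `B_{ε,η}` to itself. -/
theorem stmt16 (β : ℂ) (hβ1 : -1 < β.re) (hβ2 : β.re < 2)
    (ε η : ℝ) (hε1 : max 0 (β.re - 1) < ε) (hε2 : ε < min 1 (β.re + 1))
    (hη1 : max 0 (β.re - 1) < η) (hη2 : η < min 1 (β.re + 1)) :
    (∀ f : ℝ → ℂ, MemB ε η f →
      (∀ x : ℝ, 0 < x → IntegrableOn (fun y : ℝ => tker β x y * f y) (Ioi 0)) ∧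
      MemB ε η (fun x : ℝ => (x : ℂ) * ∫ y in Ioi (0 : ℝ), tker β x y * f y)) ∧
    ∃ C : ℝ, 0 < C ∧ ∀ f : ℝ → ℂ, MemB ε η f →
      Bnorm ε η (fun x : ℝ => (x : ℂ) * ∫ y in Ioi (0 : ℝ), tker β x y * f y) ≤
        C * Bnorm ε η f := by
  obtain ⟨h0ε, hlε⟩ := max_lt_iff.1 hε1
  obtain ⟨h1ε, huε⟩ := lt_min_iff.1 hε2
  obtain ⟨h0η, hlη⟩ := max_lt_iff.1 hη1
  obtain ⟨h1η, huη⟩ := lt_min_iff.1 hη2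
  have hE := integrableOn_norm_tker_one_mul_rpow β h0ε h1ε hlε huε
  have hH := integrableOn_norm_tker_one_mul_rpow β h0η h1η hlη huη
  set I := ∫ t in Ioi (0 : ℝ), (‖tker β 1 t‖ * t ^ (-ε) + ‖tker β 1 t‖ * t ^ (-η)) with hI
  have hI0 : 0 ≤ I := by
    refine setIntegral_nonneg measurableSet_Ioi fun t ht => ?_
    have : 0 < t := ht
    positivity
  have hgt : ∀ f : ℝ → ℂ, MemB ε η f → ∀ x : ℝ, 1 < x →
      x ^ ε * ‖(x : ℂ) * ∫ y in Ioi (0 : ℝ), tker β x y * f y‖ ≤ I * Bnorm ε η f := by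
    intro f hf x hx
    have hx0 : 0 < x := by linarith
    rw [mul_integral_tker β f hx0]
    exact mul_norm_integral_tker_one_le (by positivity)
      (fun t ht => hf.rpow_mul_norm_comp_mul_le_of_one_lt hx ht) hE hH
  have hlt : ∀ f : ℝ → ℂ, MemB ε η f → ∀ x : ℝ, 0 < x → x < 1 →
      x ^ η * ‖(x : ℂ) * ∫ y in Ioi (0 : ℝ), tker β x y * f y‖ ≤ I * Bnorm ε η f := by
    intro f hf x hx0 hx
    rw [mul_integral_tker β f hx0]
    exact mul_norm_integral_tker_one_le (by positivity)
      (fun t ht => hf.rpow_mul_norm_comp_mul_le_of_lt_one hx0 hx ht) hE hH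
  refine ⟨fun f hf => ⟨fun x hx => ?_, ?_, _, hgt f hf, hlt f hf⟩, 2 * I + 1, by linarith,
    fun f hf => ?_⟩
  · have h := (hf.integrableOn_tker_one_mul_comp hE hH hx).const_mul (1 / (x : ℂ) ^ 2)
    have h2 := integrableOn_Ioi_comp_mul_left_iff (fun y => tker β x y * f y) 0 hx
    rw [mul_zero] at h2
    refine h2.1 (h.congr (Filter.Eventually.of_forall fun t => ?_))
    simp only [tker_mul_left β hx]
    ring
  · exact (hf.continuousOn_integral_tker_one h0ε.le h0η.le hE hH).congr
      fun x hx => mul_integral_tker β f hx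
  · have hN : 0 ≤ Bnorm ε η f := Bnorm_nonneg
    have h1 : Bnorm ε η (fun x : ℝ => (x : ℂ) * ∫ y in Ioi (0 : ℝ), tker β x y * f y) ≤
        I * Bnorm ε η f + I * Bnorm ε η f := by
      refine add_le_add (Real.sSup_le ?_ (by positivity)) (Real.sSup_le ?_ (by positivity))
      · rintro _ ⟨x, hx, rfl⟩
        exact hgt f hf x hx
      · rintro _ ⟨x, hx, rfl⟩
        exact hlt f hf x hx.1 hx.2
    linarith

end
end
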